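/- arXiv:0903.3270 — 14 statements merged into one kernel-verified Lean document; each statement's English description precedes it below -/
import Mathlib

section
/- Let n be an odd prime number and K a field whose characteristic is 0 or does not divide the order of G. Let G be a finite subgroup of SL(n, K) such that 1 is not an eigenvalue of any matrix in G except the identity matrix. Then G is a cyclic group. -/
/-- A finite noncyclic group all of whose proper subgroups are cyclic is generated by a normal
cyclic subgroup of prime index `r` together with one more element. -/
theorem exists_normal_zpowers_of_forall_proper_isCyclic {G : Type*} [Group G] [Finite G]
    (hG : ¬ IsCyclic G) (hsub : ∀ H : Subgroup G, H ≠ ⊤ → IsCyclic H) :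
    ∃ (r : ℕ) (a b : G), r.Prime ∧ (Subgroup.zpowers a).Normal ∧ b ^ r ∈ Subgroup.zpowers a ∧
      ∀ g : G, ∃ (i : Fin r) (j : ℕ), g = b ^ (i : ℕ) * a ^ j := by
  have : Nontrivial G := by
    by_contra h
    rw [not_nontrivial_iff_subsingleton] at h
    exact hG inferInstance
  have hlt : commutator G < ⊤ := by
    by_cases hp : ∃ p : ℕ, p.Prime ∧ ∃ P : Sylow p G, (P : Subgroup G) = ⊤
    · obtain ⟨p, hp, P, hP⟩ := hp
      have := Fact.mk hp
      have hPG : IsPGroup p G := by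
        have h := P.isPGroup'
        rw [hP] at h
        exact h.of_equiv Subgroup.topEquiv
      have := hPG.isNilpotent
      exact Group.IsSolvable.commutator_lt_top_of_nontrivial G
    · push Not at hp
      have : IsZGroup G := ⟨fun p h P ↦ hsub _ (hp p h P)⟩
      exact IsZGroup.commutator_lt G
  obtain ⟨M, hM, hle⟩ := (eq_top_or_exists_le_coatom (commutator G)).resolve_left hlt.ne
  have hMn : M.Normal := Subgroup.Normal.of_commutator_le G hle
  obtain ⟨a, rfl⟩ := Subgroup.isCyclic_iff_exists_zpowers_eq_top M |>.1 (hsub M hM.1)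
  obtain ⟨c, -, hc⟩ := SetLike.exists_of_lt hM.lt_top
  have hc1 : orderOf (c : G ⧸ Subgroup.zpowers a) ≠ 1 := by
    rwa [Ne, orderOf_eq_one_iff, QuotientGroup.eq_one_iff]
  obtain ⟨r, hr, m, hm⟩ := Nat.exists_prime_and_dvd hc1
  have hpos := orderOf_pos (c : G ⧸ Subgroup.zpowers a)
  have hb : c ^ m ∉ Subgroup.zpowers a := by
    intro h
    rw [← QuotientGroup.eq_one_iff, QuotientGroup.mk_pow] at h
    have h1 := Nat.le_of_dvd (by grind) (orderOf_dvd_of_pow_eq_one h)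
    have h2 := hr.two_le
    nlinarith
  have hbr : (c ^ m) ^ r ∈ Subgroup.zpowers a := by
    rw [← QuotientGroup.eq_one_iff, ← pow_mul, mul_comm m, ← hm, QuotientGroup.mk_pow,
      pow_orderOf_eq_one]
  refine ⟨r, a, c ^ m, hr, hMn, hbr, fun g ↦ ?_⟩
  generalize c ^ m = b at hb hbr
  have htop : Subgroup.zpowers b ⊔ Subgroup.zpowers a = ⊤ :=
    hM.2 _ (lt_of_le_of_ne le_sup_right fun h ↦ hb (h ▸ Subgroup.mem_sup_left (by simp)))
  obtain ⟨y, hy, z, hz, rfl⟩ := Subgroup.mem_sup_of_normal_right.1 (htop ▸ Subgroup.mem_top g)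
  rw [← mem_powers_iff_mem_zpowers] at hy
  obtain ⟨k, rfl⟩ := hy
  have : b ^ k = b ^ (k % r) * (b ^ r) ^ (k / r) := by
    rw [← pow_mul, ← pow_add, Nat.mod_add_div]
  have hz' := mul_mem (pow_mem hbr (k / r)) hz
  rw [← mem_powers_iff_mem_zpowers] at hz'
  obtain ⟨j, hj⟩ := hz'
  exact ⟨⟨k % r, Nat.mod_lt _ hr.pos⟩, j, by simp only at hj ⊢; rw [hj, this, mul_assoc]⟩

namespace Representation

variable {L G V : Type*} [Field L] [Group G] [AddCommGroup V] [Module L V]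

/-- A representation is free if no nontrivial group element fixes a nonzero vector; this is the
form of the condition that passes to quotients. -/
def IsFixedPointFree (ρ : Representation L G V) : Prop :=
  ∀ g : G, g ≠ 1 → Function.Surjective (ρ g - 1 : Module.End L V)

variable {ρ : Representation L G V}

theorem IsFixedPointFree.eq_one [FiniteDimensional L V] (hρ : ρ.IsFixedPointFree) {g : G} {v : V}
    (hv : v ≠ 0) (h : ρ g v = v) : g = 1 := by
  by_contra hg
  refine hv (LinearMap.injective_iff_surjective.2 (hρ g hg) ?_)
  simp [h]

theorem IsFixedPointFree.eq [FiniteDimensional L V] (hρ : ρ.IsFixedPointFree) {g h : G} {v : V}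
    (hv : v ≠ 0) (hgh : ρ g v = ρ h v) : g = h := by
  have : ρ (h⁻¹ * g) v = v := by
    rw [map_mul, Module.End.mul_apply, hgh, ← Module.End.mul_apply, ← map_mul]
    simp
  exact (inv_mul_eq_one.1 (hρ.eq_one hv this)).symm

theorem IsFixedPointFree.comp {H : Type*} [Group H] (hρ : ρ.IsFixedPointFree) {f : H →* G}
    (hf : Function.Injective f) : IsFixedPointFree (ρ.comp f : Representation L H V) :=
  fun g hg ↦ hρ (f g) ((map_ne_one_iff f hf).2 hg)

theorem IsFixedPointFree.quotient (hρ : ρ.IsFixedPointFree) {W : Submodule L V}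
    (hW : ∀ g, W ≤ W.comap (ρ g)) : (ρ.quotient W hW).IsFixedPointFree := by
  intro g hg x
  obtain ⟨x, rfl⟩ := W.mkQ_surjective x
  obtain ⟨y, rfl⟩ := hρ g hg x
  exact ⟨W.mkQ y, by simp [Representation.quotient]⟩

theorem pow_apply_of_eigen {a : G} {v : V} {c : L} (h : ρ a v = c • v) (j : ℕ) :
    ρ (a ^ j) v = c ^ j • v := by
  induction j with
  | zero => simp
  | succ j ih => rw [pow_succ, map_mul, Module.End.mul_apply, h, map_smul, ih, smul_smul, pow_succ']

/-- A group with a common eigenvector in a fixed-point-free representation is cyclic. -/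
theorem IsFixedPointFree.isCyclic_of_common_eigenvector [Finite G] [FiniteDimensional L V]
    (hρ : ρ.IsFixedPointFree) {v : V} (hv : v ≠ 0) (h : ∀ g, ∃ c : L, ρ g v = c • v) :
    IsCyclic G := by
  choose c hc using h
  have hinj := smul_left_injective L hv
  let f : G →* L :=
    { toFun := c
      map_one' := hinj (by simp [← hc])
      map_mul' := fun g g' ↦ hinj (by
        simp only
        rw [← hc, map_mul, Module.End.mul_apply, hc, map_smul, hc, smul_smul, mul_comm]) }
  refine isCyclic_of_injective_ringHom f fun g g' hgg ↦ hρ.eq hv ?_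
  rw [hc, hc]
  exact congrArg (· • v) hgg

theorem IsFixedPointFree.isCyclic_of_commute [Finite G] [IsAlgClosed L] [FiniteDimensional L V]
    [Nontrivial V] (hρ : ρ.IsFixedPointFree) {a b : G} (hab : Commute a b)
    (hG : ∀ g : G, ∃ i j : ℕ, g = b ^ i * a ^ j) : IsCyclic G := by
  obtain ⟨c, hc⟩ := Module.End.exists_eigenvalue (ρ a)
  have hmaps : Set.MapsTo (ρ b) (Module.End.eigenspace (ρ a) c) (Module.End.eigenspace (ρ a) c) :=
    Module.End.mapsTo_genEigenspace_of_comm (hab.map ρ) c 1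
  have : Nontrivial (Module.End.eigenspace (ρ a) c) := Submodule.nontrivial_iff_ne_bot.2 hc
  obtain ⟨d, hd⟩ := Module.End.exists_eigenvalue ((ρ b).restrict hmaps)
  obtain ⟨⟨v, hva⟩, hvb⟩ := hd.exists_hasEigenvector
  have hv0 : v ≠ 0 := fun h ↦ hvb.2 (by simp [h])
  have hb : ρ b v = d • v := congrArg Subtype.val hvb.apply_eq_smul
  have ha : ρ a v = c • v := Module.End.mem_eigenspace_iff.1 hva
  refine hρ.isCyclic_of_common_eigenvector hv0 fun g ↦ ?_
  obtain ⟨i, j, rfl⟩ := hG g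
  exact ⟨c ^ j * d ^ i, by
    rw [map_mul, Module.End.mul_apply, pow_apply_of_eigen ha, map_smul, pow_apply_of_eigen hb,
      smul_smul]⟩

theorem commute_of_commute_pow {a b : G} {r i j : ℕ} (hr : r.Prime) (hi : i < r) (hj : j < r)
    (hbr : Commute a (b ^ r)) (hne : i ≠ j) (h : Commute a (b ^ ((i : ℤ) - j))) :
    Commute a b := by
  have hco : IsCoprime (r : ℤ) ((i : ℤ) - j) := by
    refine (Int.prime_iff_natAbs_prime.2 (by simpa)).coprime_iff_not_dvd.2 fun hd ↦ ?_
    have := Int.eq_zero_of_abs_lt_dvd hd (by grind)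
    omega
  obtain ⟨u, w, huw⟩ := hco
  have : b = (b ^ r) ^ u * (b ^ ((i : ℤ) - j)) ^ w := by
    rw [← zpow_natCast, ← zpow_mul, ← zpow_mul, ← zpow_add, mul_comm _ w,
      mul_comm _ u, huw, zpow_one]
  rw [this]
  exact (hbr.zpow_right u).mul_right (h.zpow_right w)

/-- The translates of an eigenvector of `a` by the powers of `b` are linearly independent. -/
theorem IsFixedPointFree.linearIndependent [Finite G] [FiniteDimensional L V]
    (hρ : ρ.IsFixedPointFree) {a b : G} {r : ℕ} (hr : r.Prime) (hn : (Subgroup.zpowers a).Normal)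
    (hbr : b ^ r ∈ Subgroup.zpowers a) (hab : ¬ Commute a b) {v : V} (hv : v ≠ 0) {c : L}
    (hc : ρ a v = c • v) :
    LinearIndependent L (fun i : Fin r ↦ ρ (b ^ (i : ℕ)) v) := by
  have hconj : ∀ i : ℕ, ∃ m : ℕ, a ^ m = (b ^ i)⁻¹ * a * b ^ i := fun i ↦ by
    have := hn.conj_mem a (Subgroup.mem_zpowers a) (b ^ i)⁻¹
    rw [inv_inv, ← mem_powers_iff_mem_zpowers] at this
    exact this
  have hbr' : Commute a (b ^ r) := by
    obtain ⟨k, hk⟩ := hbr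
    rw [← hk]
    exact (Commute.refl a).zpow_right k
  choose m hm using hconj
  refine Module.End.eigenvectors_linearIndependent' (ρ a) (fun i : Fin r ↦ c ^ m i) ?_ _ ?_
  · intro i j hij
    have h1 : a ^ m i = a ^ m j := hρ.eq hv (by
      rw [pow_apply_of_eigen hc, pow_apply_of_eigen hc]; exact congrArg (· • v) hij)
    rw [hm, hm] at h1
    by_contra hne
    refine hab (commute_of_commute_pow hr i.2 j.2 hbr' (fun h ↦ hne (Fin.ext h)) ?_)
    rw [zpow_sub, zpow_natCast, zpow_natCast]
    have h2 : a * b ^ (i : ℕ) = b ^ (i : ℕ) * ((b ^ (j : ℕ))⁻¹ * a * b ^ (j : ℕ)) := by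
      rw [← h1]; group
    change a * (b ^ (i : ℕ) * (b ^ (j : ℕ))⁻¹) = b ^ (i : ℕ) * (b ^ (j : ℕ))⁻¹ * a
    rw [← mul_assoc, h2]
    simp only [mul_assoc, mul_inv_cancel, mul_one]
  · intro i
    rw [Module.End.hasEigenvector_iff, Module.End.mem_eigenspace_iff]
    constructor
    · have : a * b ^ (i : ℕ) = b ^ (i : ℕ) * a ^ m i := by rw [hm]; group
      rw [← Module.End.mul_apply, ← map_mul, this, map_mul, Module.End.mul_apply,
        pow_apply_of_eigen hc, map_smul]
    · intro h
      have : ρ (b ^ (i : ℕ))⁻¹ (ρ (b ^ (i : ℕ)) v) = v := by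
        rw [← Module.End.mul_apply, ← map_mul]; simp
      exact hv (by rw [← this, h, map_zero])

/-- If `G` is a noncommutative extension of a cyclic group of prime order `r` by a cyclic group,
then `r` divides the dimension of every fixed-point-free representation of `G`. -/
theorem IsFixedPointFree.dvd_finrank [Finite G] [IsAlgClosed L] {a b : G} {r : ℕ} (hr : r.Prime)
    (hn : (Subgroup.zpowers a).Normal) (hbr : b ^ r ∈ Subgroup.zpowers a) (hab : ¬ Commute a b)
    (hG : ∀ g : G, ∃ (i : Fin r) (j : ℕ), g = b ^ (i : ℕ) * a ^ j)
    (V : Type*) [AddCommGroup V] [Module L V] [FiniteDimensional L V] (ρ : Representation L G V)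
    (hρ : ρ.IsFixedPointFree) : r ∣ Module.finrank L V := by
  induction hd : Module.finrank L V using Nat.strong_induction_on generalizing V with
  | _ d ih =>
    subst hd
    rcases subsingleton_or_nontrivial V with _ | _
    · simp [Module.finrank_zero_of_subsingleton]
    obtain ⟨c, hc⟩ := Module.End.exists_eigenvalue (ρ a)
    obtain ⟨v, hv⟩ := hc.exists_hasEigenvector
    have hli := hρ.linearIndependent hr hn hbr hab hv.2 hv.apply_eq_smul
    set W := Submodule.span L (Set.range fun i : Fin r ↦ ρ (b ^ (i : ℕ)) v) with hWdef
    have hmem : ∀ g, ρ g v ∈ W := fun g ↦ by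
      obtain ⟨i, j, rfl⟩ := hG g
      rw [map_mul, Module.End.mul_apply, pow_apply_of_eigen hv.apply_eq_smul, map_smul]
      exact W.smul_mem _ (Submodule.subset_span ⟨i, rfl⟩)
    have hW : ∀ g, W ≤ W.comap (ρ g) := fun g ↦ by
      rw [hWdef, Submodule.span_le]
      rintro _ ⟨i, rfl⟩
      simp only [Submodule.comap_coe, Set.mem_preimage, ← Module.End.mul_apply, ← map_mul]
      exact hmem _
    have hWr : Module.finrank L W = r := by simpa using finrank_span_eq_card hli
    have hsum := W.finrank_quotient_add_finrank
    rw [← hsum, hWr]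
    have := hr.pos
    exact (ih _ (by omega) (V ⧸ W) (ρ.quotient W hW) (hρ.quotient hW) rfl).add (dvd_refl r)

/-- If `v, f v, …, f ^ (n - 1) v` is a basis and `f ^ n v = μ v` with `n` odd, then
`det f = μ`. -/
theorem det_eq_of_linearIndependent_pow [FiniteDimensional L V] {n : ℕ}
    (hn : Module.finrank L V = n) (hodd : Odd n) (f : Module.End L V) {v : V} {μ : L}
    (hli : LinearIndependent L (fun i : Fin n ↦ (f ^ (i : ℕ)) v)) (hf : (f ^ n) v = μ • v) :
    LinearMap.det f = μ := by
  have hdeg : f.charpoly.natDegree = n := by rw [LinearMap.charpoly_natDegree, hn]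
  have hlead : f.charpoly.coeff n = 1 := by
    rw [← hdeg]; exact f.charpoly_monic
  have h0 : Polynomial.aeval f f.charpoly v = 0 := by rw [f.aeval_self_charpoly]; rfl
  rw [Polynomial.aeval_eq_sum_range, hdeg, Finset.sum_range_succ, hlead, one_smul,
    LinearMap.add_apply, hf, LinearMap.sum_apply, Finset.sum_range] at h0
  have hpos : 0 < n := hodd.pos
  have := Fintype.linearIndependent_iff.1 hli
    (fun i ↦ f.charpoly.coeff i + if i = ⟨0, hpos⟩ then μ else 0) (by
      simpa [add_smul, Finset.sum_add_distrib, ite_smul] using h0) ⟨0, hpos⟩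
  rw [LinearMap.det_eq_sign_charpoly_coeff, hn, hodd.neg_one_pow]
  simp at this
  linear_combination -this

/-- A finite group with a fixed-point-free representation of odd prime dimension and determinant
one is cyclic. -/
theorem IsFixedPointFree.isCyclic [IsAlgClosed L] [FiniteDimensional L V]
    (hp : (Module.finrank L V).Prime) (hodd : Odd (Module.finrank L V)) {G : Type*} [Group G]
    [Finite G] (ρ : Representation L G V) (hρ : ρ.IsFixedPointFree)
    (hdet : ∀ g, LinearMap.det (ρ g) = 1) : IsCyclic G := by
  induction hd : Nat.card G using Nat.strong_induction_on generalizing G with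
  | _ d ih =>
    subst hd
    by_contra hcyc
    obtain ⟨r, a, b, hr, hn, hbr, hG⟩ :=
      exists_normal_zpowers_of_forall_proper_isCyclic hcyc fun H hH ↦
        ih _ (lt_of_le_of_ne H.card_le_card_group (mt H.eq_top_of_card_eq hH))
          (ρ.comp H.subtype) (hρ.comp H.subtype_injective) (fun g ↦ hdet g) rfl
    have : Nontrivial V := Module.nontrivial_of_finrank_pos (R := L) hp.pos
    have hab : ¬ Commute a b := fun h ↦ hcyc <| hρ.isCyclic_of_commute h fun g ↦ by
      obtain ⟨i, j, h⟩ := hG g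
      exact ⟨i, j, h⟩
    obtain rfl := (Nat.prime_dvd_prime_iff_eq hr hp).1
      (IsFixedPointFree.dvd_finrank hr hn hbr hab hG V ρ hρ)
    obtain ⟨c, hc⟩ := Module.End.exists_eigenvalue (ρ a)
    obtain ⟨v, hv⟩ := hc.exists_hasEigenvector
    have hli := hρ.linearIndependent hr hn hbr hab hv.2 hv.apply_eq_smul
    rw [← mem_powers_iff_mem_zpowers] at hbr
    obtain ⟨t, ht⟩ := hbr
    have hbv := pow_apply_of_eigen hv.apply_eq_smul t
    simp only at ht
    rw [ht] at hbv
    have hμ : c ^ t = 1 := by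
      rw [← hdet b]
      refine (det_eq_of_linearIndependent_pow rfl hodd (ρ b) (v := v) ?_ ?_).symm
      · simpa only [map_pow] using hli
      · rwa [← map_pow]
    rw [hμ, one_smul] at hbv
    have hw : ρ b (∑ i ∈ Finset.range (Module.finrank L V), ρ (b ^ i) v) =
        ∑ i ∈ Finset.range (Module.finrank L V), ρ (b ^ i) v := by
      rw [map_sum]
      simp_rw [← Module.End.mul_apply, ← map_mul, ← pow_succ']
      have h := Finset.sum_range_succ' (fun i ↦ ρ (b ^ i) v) (Module.finrank L V)
      rw [Finset.sum_range_succ, hbv] at h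
      simpa using h.symm
    refine hab ?_
    rw [hρ.eq_one (fun h0 ↦ ?_) hw]
    · exact Commute.one_right a
    · rw [Finset.sum_range] at h0
      exact one_ne_zero (Fintype.linearIndependent_iff.1 hli (fun _ ↦ 1) (by simpa using h0)
        ⟨0, hp.pos⟩)

end Representation

/-- Gorenstein isolated quotient singularities paper, Lemma 1.3:
If `n` is an odd prime and `G` is a finite subgroup of `SL(n, K)`, where the
characteristic of `K` is `0` or does not divide `#G` (i.e. `#G` is invertible in `K`),
such that `1` is not an eigenvalue (root of the characteristic polynomial) of any
matrix in `G` except the identity, then `G` is cyclic. -/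
theorem stmt0 (n : ℕ) (hp : n.Prime) (hodd : Odd n) (K : Type*) [Field K]
    (G : Subgroup (Matrix.SpecialLinearGroup (Fin n) K)) [Finite G]
    (hchar : (Nat.card G : K) ≠ 0)
    (h1 : ∀ g ∈ G, g ≠ 1 →
      Polynomial.eval 1 (Matrix.charpoly (g : Matrix (Fin n) (Fin n) K)) ≠ 0) :
    IsCyclic G := by
  let L := AlgebraicClosure K
  let φ : Matrix (Fin n) (Fin n) K →+* Matrix (Fin n) (Fin n) L := (algebraMap K L).mapMatrix
  let ρ : Representation L G (Fin n → L) :=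
    { toFun := fun g ↦ Matrix.toLin' (φ (g : Matrix.SpecialLinearGroup (Fin n) K))
      map_one' := by simp [Module.End.one_eq_id]
      map_mul' := fun g h ↦ by simp [Matrix.toLin'_mul, Module.End.mul_eq_comp] }
  have hfin : Module.finrank L (Fin n → L) = n := by simp
  refine Representation.IsFixedPointFree.isCyclic (by rwa [hfin]) (by rwa [hfin]) ρ
    (fun g hg ↦ ?_) fun g ↦ ?_
  · have hne := h1 g g.2 (by simpa using hg)
    rw [Matrix.eval_charpoly, map_one] at hne
    have hdet : LinearMap.det (1 - ρ g) ≠ 0 := by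
      have : 1 - ρ g = Matrix.toLin' (φ (1 - (g : Matrix.SpecialLinearGroup (Fin n) K))) := by
        rw [map_sub, map_one, map_sub, Matrix.toLin'_one]
        rfl
      rw [this, LinearMap.det_toLin', ← RingHom.map_det]
      exact (map_ne_zero _).2 hne
    intro x
    obtain ⟨y, hy⟩ := (LinearMap.equivOfDetNeZero _ hdet).surjective (-x)
    refine ⟨y, ?_⟩
    rw [← neg_sub, LinearMap.neg_apply, ← neg_neg x]
    exact congrArg Neg.neg hy
  · change LinearMap.det (Matrix.toLin' (φ _)) = 1
    rw [LinearMap.det_toLin', ← RingHom.map_det]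
    simp
end

section
/- Let K be an algebraically closed field and G a finite abelian subgroup of GL(n, K) whose order is invertible in K (the characteristic of K is 0 or does not divide the order of G). Assume 1 is not an eigenvalue of any matrix in G except the identity matrix. Then G is a cyclic group. -/
/-- In a nontrivial commutative Artinian ring, a finite group of elements whose nontrivial members
differ from `1` by non-zero-divisors embeds in a residue field, hence is cyclic. -/
theorem isCyclic_of_sub_one_mem_nonZeroDivisors {R G : Type*} [CommRing R] [Nontrivial R]
    [IsArtinianRing R] [Group G] [Finite G] (f : G →* R)
    (hf : ∀ g, g ≠ 1 → f g - 1 ∈ nonZeroDivisors R) : IsCyclic G := by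
  obtain ⟨m, hm⟩ := Ideal.exists_maximal R
  refine isCyclic_of_injective_ringHom ((Ideal.Quotient.mk m : R →* R ⧸ m).comp f) ?_
  rw [injective_iff_map_eq_one]
  intro g hg
  by_contra hne
  have hmem : f g - 1 ∈ m := by
    rw [← Ideal.Quotient.mk_eq_mk_iff_sub_mem, map_one]
    exact hg
  exact hm.ne_top (Ideal.eq_top_of_isUnit_mem _ hmem
    (IsArtinianRing.isUnit_of_mem_nonZeroDivisors (hf g hne)))

/-- If `K` is an algebraically closed field, `G` a finite *abelian* subgroup of
`GL(n, K)` whose order is invertible in `K`, and `1` is not an eigenvalue (root of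
the characteristic polynomial) of any matrix in `G` except the identity, then `G`
is cyclic. -/
theorem stmt1 (n : ℕ) (K : Type*) [Field K] [IsAlgClosed K]
    (G : Subgroup (GL (Fin n) K)) [Finite G]
    (hab : ∀ a ∈ G, ∀ b ∈ G, a * b = b * a)
    (hchar : (Nat.card G : K) ≠ 0)
    (h1 : ∀ g ∈ G, g ≠ 1 →
      Polynomial.eval 1 (Matrix.charpoly (g : Matrix (Fin n) (Fin n) K)) ≠ 0) :
    IsCyclic G := by
  rcases isEmpty_or_nonempty (Fin n) with hn | hn
  · have : Subsingleton (GL (Fin n) K) := ⟨fun a b => Units.ext (Subsingleton.elim _ _)⟩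
    infer_instance
  let S : Set (Matrix (Fin n) (Fin n) K) := (fun g : GL (Fin n) K => g.val) '' G
  have hS : ∀ a ∈ S, ∀ b ∈ S, a * b = b * a := by
    rintro _ ⟨a, ha, rfl⟩ _ ⟨b, hb, rfl⟩
    exact congrArg Units.val (hab a ha b hb)
  let A := Algebra.adjoin K S
  have : IsMulCommutative A := Algebra.isMulCommutative_adjoin K hS
  have : IsArtinianRing A := IsArtinianRing.of_finite K A
  let f : G →* A :=
    { toFun := fun g => ⟨g.1.val, Algebra.subset_adjoin ⟨g.1, g.2, rfl⟩⟩
      map_one' := rfl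
      map_mul' := fun _ _ => rfl }
  open scoped IsMulCommutative in
  refine isCyclic_of_sub_one_mem_nonZeroDivisors f fun g hg => ?_
  have hdet := h1 g.1 g.2 (fun h => hg (Subtype.ext h))
  rw [Matrix.eval_charpoly, map_one, ← neg_sub, Matrix.det_neg] at hdet
  have hu : IsUnit ((g.1.val : Matrix (Fin n) (Fin n) K) - 1) :=
    (Matrix.isUnit_iff_isUnit_det _).2 (right_ne_zero_of_mul hdet).isUnit
  rw [mem_nonZeroDivisors_iff_right]
  intro x hx
  have hx' : x.1 * (g.1.val - 1) = 0 := congrArg Subtype.val hx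
  exact Subtype.ext (hu.mul_left_eq_zero.1 hx')
end

section
/- Let n be an odd prime number and K an algebraically closed field whose characteristic is 0 or does not divide the order of G. Let G be a finite solvable subgroup of SL(n, K) such that 1 is not an eigenvalue of any matrix in G except the identity matrix. Then G is a cyclic group. -/
section

open Polynomial

theorem dvd_sum_of_iterate_eq {α : Type*} {p : ℕ} (hp : p.Prime) (s : Finset α) (σ : α → α)
    (f : α → ℕ) (hs : ∀ a ∈ s, σ a ∈ s) (hσ : ∀ a ∈ s, σ^[p] a = a) (hne : ∀ a ∈ s, σ a ≠ a)
    (hf : ∀ a ∈ s, f (σ a) = f a) : p ∣ ∑ a ∈ s, f a := by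
  classical
  have : Fact p.Prime := ⟨hp⟩
  let t : Finset ((_ : α) × ℕ) := s.sigma fun a ↦ Finset.range (f a)
  let τ : Function.End t := fun x ↦ ⟨⟨σ x.1.1, x.1.2⟩, by
    have := Finset.mem_sigma.1 x.2
    exact Finset.mem_sigma.2 ⟨hs _ this.1, by simpa [hf _ this.1] using this.2⟩⟩
  have hτ (j : ℕ) (x : t) : ((τ ^ j) x).1 = ⟨σ^[j] x.1.1, x.1.2⟩ := by
    induction j with
    | zero => rfl
    | succ j ih =>
      rw [pow_succ', Function.iterate_succ_apply']
      change (τ ((τ ^ j) x)).1 = _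
      simp only [τ, ih]
  have h1 : τ ^ p ^ 1 = 1 := by
    funext x
    refine Subtype.ext ?_
    rw [hτ, pow_one, hσ _ (Finset.mem_sigma.1 x.2).1]
    rfl
  have h2 := Equiv.Perm.card_fixedPoints_modEq h1
  have h3 : IsEmpty (Function.fixedPoints τ) := ⟨fun x ↦ hne _ (Finset.mem_sigma.1 x.1.2).1
    (congrArg (fun y : t ↦ y.1.1) x.2)⟩
  have h4 : Fintype.card t = ∑ a ∈ s, f a := by
    rw [Fintype.card_coe, Finset.card_sigma]
    simp
  rw [← h4]
  exact Nat.modEq_zero_iff_dvd.1 (h2.trans (congrArg (· % p) Fintype.card_eq_zero))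

theorem charpoly_eq_X_pow_sub_C {K V : Type*} [Field K] [AddCommGroup V] [Module K V]
    [FiniteDimensional K V] {n : ℕ} (hn : Module.finrank K V = n) (hn0 : n ≠ 0)
    (h : Module.End K V) (v : V) (c : K) (hc : (h ^ n) v = c • v)
    (hv : LinearIndependent K fun i : Fin n ↦ (h ^ (i : ℕ)) v) :
    h.charpoly = X ^ n - C c := by
  have hd : h.charpoly.natDegree = n := by rw [LinearMap.charpoly_natDegree, hn]
  have hlt : (h.charpoly - (X ^ n - C c)).degree < (n : WithBot ℕ) := by
    have := degree_sub_lt_left (p := h.charpoly) (q := X ^ n - C c)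
      (by rw [degree_eq_natDegree h.charpoly_monic.ne_zero, hd,
        degree_X_pow_sub_C (Nat.pos_of_ne_zero hn0)])
      h.charpoly_monic.ne_zero
      (by rw [h.charpoly_monic.leadingCoeff, (monic_X_pow_sub_C c hn0).leadingCoeff])
    rwa [degree_eq_natDegree h.charpoly_monic.ne_zero, hd] at this
  have h0 : aeval h (h.charpoly - (X ^ n - C c)) v = 0 := by
    simp [LinearMap.aeval_self_charpoly, hc, Module.algebraMap_end_apply]
  rw [← sub_eq_zero]
  generalize h.charpoly - (X ^ n - C c) = q at hlt h0
  have hlt' : q.natDegree < n := by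
    rcases eq_or_ne q 0 with rfl | hq
    · simpa using Nat.pos_of_ne_zero hn0
    · exact (natDegree_lt_iff_degree_lt hq).2 hlt
  rw [aeval_def, eval₂_eq_sum_range' _ hlt',
    ← Fin.sum_univ_eq_sum_range (fun i ↦ algebraMap K (Module.End K V) (q.coeff i) * h ^ i)] at h0
  simp only [LinearMap.sum_apply, Module.End.mul_apply, Module.algebraMap_end_apply] at h0
  have := Fintype.linearIndependent_iff.1 hv _ h0
  ext i
  by_cases hi : i < n
  · exact this ⟨i, hi⟩
  · exact coeff_eq_zero_of_degree_lt (hlt.trans_le (by exact_mod_cast not_lt.1 hi))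

theorem dvd_finrank_of_mul_eq_mul_pow {K V : Type*} [Field K] [IsAlgClosed K] [AddCommGroup V]
    [Module K V] [FiniteDimensional K V] {p : ℕ} (hp : p.Prime) (f h : Module.End K V)
    (hinj : Function.Injective h) (k : ℕ) (hfh : f * h = h * f ^ k)
    (hev : ∀ a, f.HasEigenvalue a → a ^ k ^ p = a ∧ a ^ k ≠ a) : p ∣ Module.finrank K V := by
  classical
  have hpoly (P : K[X]) (v : V) : aeval f P (h v) = h (aeval f (P.comp (X ^ k)) v) := by
    induction P using Polynomial.induction_on' with
    | add P Q hP hQ => simp [hP, hQ]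
    | monomial i a =>
      have h1 : f ^ i * h = h * (f ^ k) ^ i := by
        have : SemiconjBy h (f ^ k) f := hfh.symm
        exact (this.pow_right i).symm
      have h2 := LinearMap.congr_fun h1 v
      simp only [Module.End.mul_apply] at h2
      simp [← C_mul_X_pow_eq_monomial, h2, Module.algebraMap_end_apply]
  have hle (a : K) : Module.finrank K (f.maxGenEigenspace a) ≤
      Module.finrank K (f.maxGenEigenspace (a ^ k)) := by
    have hmaps : ∀ v ∈ f.maxGenEigenspace a, h v ∈ f.maxGenEigenspace (a ^ k) := by
      intro v hv
      rw [Module.End.mem_maxGenEigenspace] at hv ⊢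
      obtain ⟨j, hj⟩ := hv
      refine ⟨j, ?_⟩
      obtain ⟨P, hP⟩ := sub_dvd_pow_sub_pow (X : K[X]) (C a) k
      have h1 (b : K) : (f - b • 1) ^ j = aeval f ((X - C b) ^ j) := by
        simp [Algebra.algebraMap_eq_smul_one]
      rw [h1] at hj ⊢
      rw [hpoly]
      have h2 : ((X - C (a ^ k)) ^ j).comp (X ^ k) = P ^ j * (X - C a) ^ j := by
        simp only [pow_comp, sub_comp, X_comp, C_comp, map_pow]
        rw [hP, mul_pow, mul_comm]
      rw [h2, map_mul, Module.End.mul_apply, hj, map_zero, map_zero]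
    refine LinearMap.finrank_le_finrank_of_injective (f := h.restrict hmaps) ?_
    intro x y hxy
    exact Subtype.ext (hinj (congrArg Subtype.val hxy))
  have hroots (a : K) : a ∈ f.charpoly.roots.toFinset ↔ f.HasEigenvalue a := by
    rw [Module.End.hasEigenvalue_iff_isRoot_charpoly, Multiset.mem_toFinset,
      mem_roots f.charpoly_monic.ne_zero]
  have hle' (a : K) (j : ℕ) : Module.finrank K (f.maxGenEigenspace a) ≤
      Module.finrank K (f.maxGenEigenspace (a ^ k ^ j)) := by
    induction j with
    | zero => rw [pow_zero, pow_one]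
    | succ j ih =>
      rw [pow_succ, pow_mul]
      exact ih.trans (hle _)
  have hsum : ∑ a ∈ f.charpoly.roots.toFinset, Module.finrank K (f.maxGenEigenspace a) =
      Module.finrank K V := by
    rw [← f.charpoly_natDegree, (IsAlgClosed.splits f.charpoly).natDegree_eq_card_roots,
      ← Multiset.toFinset_sum_count_eq]
    exact Finset.sum_congr rfl fun a _ ↦ by
      rw [LinearMap.finrank_maxGenEigenspace_eq, count_roots]
  rw [← hsum]
  refine dvd_sum_of_iterate_eq hp _ (· ^ k) _ ?_ ?_ ?_ ?_
  · intro a ha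
    rw [hroots] at ha ⊢
    obtain ⟨v, hv⟩ := ha.exists_hasEigenvector
    refine Module.End.hasEigenvalue_of_hasEigenvector (x := h v) ⟨?_, ?_⟩
    · rw [Module.End.mem_eigenspace_iff]
      have := hpoly X v
      simpa [hv.pow_apply] using this
    · exact fun h0 ↦ hv.2 (hinj (h0.trans (map_zero h).symm))
  · intro a ha
    rw [pow_iterate]
    exact (hev a ((hroots a).1 ha)).1
  · intro a ha
    exact (hev a ((hroots a).1 ha)).2
  · intro a ha
    refine le_antisymm ?_ (hle a)
    obtain ⟨q, hq⟩ := Nat.exists_eq_succ_of_ne_zero hp.ne_zero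
    calc _ ≤ _ := hle' (a ^ k) q
      _ = _ := by rw [← pow_mul, ← pow_succ', ← Nat.succ_eq_add_one, ← hq,
        (hev a ((hroots a).1 ha)).1]

theorem exists_common_eigenvector_of_comm {K V : Type*} [Field K] [IsAlgClosed K]
    [AddCommGroup V] [Module K V] [FiniteDimensional K V] [Nontrivial V] {G : Type*} [Group G]
    (ρ : G →* Module.End K V)
    (hcard : (Nat.card G : K) ≠ 0) (hcomm : ∀ a b : G, a * b = b * a) :
    ∃ v : V, v ≠ 0 ∧ ∀ g, ∃ c : K, ρ g v = c • v := by
  have hss (g : G) : (ρ g).IsFinitelySemisimple := by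
    refine Module.End.IsSemisimple.isFinitelySemisimple ?_
    refine Module.End.isSemisimple_of_squarefree_aeval_eq_zero (p := X ^ Nat.card G - 1)
      (X_pow_sub_one_separable_iff.2 hcard).squarefree ?_
    rw [map_sub, map_pow, aeval_X, ← map_pow, pow_card_eq_one', map_one, map_one, sub_self]
  have htop := Module.End.iSup_iInf_maxGenEigenspace_eq_top_of_iSup_maxGenEigenspace_eq_top_of_commute
    (fun g ↦ ρ g) (fun a b _ ↦ by
      change ρ a * ρ b = ρ b * ρ a
      rw [← map_mul, hcomm, map_mul]) fun g ↦ Module.End.iSup_maxGenEigenspace_eq_top _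
  obtain ⟨χ, hχ⟩ : ∃ χ : G → K, ⨅ g, (ρ g).maxGenEigenspace (χ g) ≠ ⊥ := by
    by_contra! h
    simp [h] at htop
  obtain ⟨v, hv, hv0⟩ := Submodule.exists_mem_ne_zero_of_ne_bot hχ
  refine ⟨v, hv0, fun g ↦ ⟨χ g, ?_⟩⟩
  have := (Submodule.mem_iInf _).1 hv g
  rwa [(hss g).maxGenEigenspace_eq_eigenspace, Module.End.mem_eigenspace_iff] at this

theorem isCyclic_of_comm_of_fixedPointFree {K V : Type*} [Field K] [IsAlgClosed K]
    [AddCommGroup V] [Module K V] [FiniteDimensional K V] [Nontrivial V] {G : Type*} [Group G] [Finite G]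
    (ρ : G →* Module.End K V)
    (hcard : (Nat.card G : K) ≠ 0) (hfree : ∀ g ≠ 1, ∀ v, ρ g v = v → v = 0)
    (hcomm : ∀ a b : G, a * b = b * a) : IsCyclic G := by
  obtain ⟨v, hv, hc⟩ := exists_common_eigenvector_of_comm ρ hcard hcomm
  choose χ hχ using hc
  let φ : G →* K :=
    { toFun := χ
      map_one' := smul_left_injective K hv (by simp [← hχ])
      map_mul' := fun a b ↦ smul_left_injective K hv (by
        simp [← hχ, mul_smul]
        simp [hχ, smul_smul, mul_comm]) }
  refine isCyclic_of_injective_ringHom φ ((injective_iff_map_eq_one φ).2 fun g hg ↦ ?_)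
  by_contra hne
  refine hv (hfree g hne v ?_)
  rw [hχ, show χ g = 1 from hg, one_smul]

theorem exists_normal_isCoatom_prime_index (G : Type*) [Group G] [Finite G] [Nontrivial G]
    [Group.IsSolvable G] : ∃ N : Subgroup G, N.Normal ∧ IsCoatom N ∧ N.index.Prime := by
  obtain ⟨N, hN, hle⟩ := (eq_top_or_exists_le_coatom (commutator G)).resolve_left
    (Group.IsSolvable.commutator_lt_top_of_nontrivial G).ne
  have hnorm : N.Normal := Subgroup.Normal.of_commutator_le G hle
  refine ⟨N, hnorm, hN, ?_⟩
  have hcomm : IsMulCommutative (G ⧸ N) :=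
    Subgroup.Normal.quotient_commutative_iff_commutator_le.2 hle
  let _ : CommGroup (G ⧸ N) :=
    { (inferInstance : Group (G ⧸ N)) with mul_comm := hcomm.is_comm.comm }
  have : IsSimpleGroup (G ⧸ N) :=
    { toNontrivial := QuotientGroup.nontrivial_iff.2 hN.1
      eq_bot_or_eq_top_of_normal := fun H _ ↦ by
        have hinj := Subgroup.comap_injective (QuotientGroup.mk'_surjective N)
        have hNH : N ≤ H.comap (QuotientGroup.mk' N) := by
          conv_lhs => rw [← QuotientGroup.ker_mk' N]
          exact Subgroup.ker_le_comap _ _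
        rcases hN.le_iff.1 hNH with h | h
        · exact .inr (hinj (by rw [h, Subgroup.comap_top]))
        · refine .inl (hinj ?_)
          rw [h, MonoidHom.comap_bot, QuotientGroup.ker_mk'] }
  exact CommGroup.is_simple_iff_prime_card.1 this

theorem mul_comm_of_isCoatom_of_commute {G : Type*} [Group G] {N : Subgroup G} (hN : IsCoatom N)
    {x h : G} (hx : ∀ g ∈ N, g ∈ Subgroup.zpowers x) (hh : h ∉ N) (hxh : Commute x h) (a b : G) :
    a * b = b * a := by
  have htop : ∀ H : Subgroup G, N ≤ H → h ∈ H → H = ⊤ := fun H hNH hhH ↦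
    (hN.le_iff.1 hNH).resolve_right fun e ↦ hh (e ▸ hhH)
  have hNx (y : G) (hxy : Commute x y) : N ≤ Subgroup.centralizer {y} := fun g hg ↦ by
    obtain ⟨i, rfl⟩ := Subgroup.mem_zpowers_iff.1 (hx g hg)
    exact Subgroup.mem_centralizer_singleton_iff.2 (hxy.zpow_left i)
  have hx_top : Subgroup.centralizer {x} = ⊤ :=
    htop _ (hNx x (Commute.refl x)) (Subgroup.mem_centralizer_singleton_iff.2 hxh.symm)
  have hh_top : Subgroup.centralizer {h} = ⊤ :=
    htop _ (hNx h hxh) (Subgroup.mem_centralizer_singleton_iff.2 rfl)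
  have ha_top : Subgroup.centralizer {a} = ⊤ := by
    have hax : a ∈ Subgroup.centralizer {x} := hx_top ▸ Subgroup.mem_top a
    have hah : a ∈ Subgroup.centralizer {h} := hh_top ▸ Subgroup.mem_top a
    rw [Subgroup.mem_centralizer_singleton_iff] at hax hah
    exact htop _ (hNx a hax.symm) (Subgroup.mem_centralizer_singleton_iff.2 hah.symm)
  have hb : b ∈ Subgroup.centralizer {a} := ha_top ▸ Subgroup.mem_top b
  exact (Subgroup.mem_centralizer_singleton_iff.1 hb).symm

theorem isCyclic_of_fixedPointFree_of_isCoatom {K V : Type*} [Field K] [IsAlgClosed K]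
    [AddCommGroup V] [Module K V] [FiniteDimensional K V] {n : ℕ} (hn : n.Prime) (hodd : Odd n)
    (hV : Module.finrank K V = n) {G : Type*} [Group G] [Finite G] (ρ : G →* Module.End K V)
    (hcard : (Nat.card G : K) ≠ 0) (hfree : ∀ g ≠ 1, ∀ v, ρ g v = v → v = 0)
    (hdet : ∀ g, LinearMap.det (ρ g) = 1) (N : Subgroup G) [N.Normal] (hN : IsCoatom N)
    (hp : N.index.Prime) [IsCyclic N] : IsCyclic G := by
  have hV1 : Nontrivial V := Module.nontrivial_of_finrank_pos (R := K) (hV ▸ hn.pos)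
  obtain ⟨⟨x, hxN⟩, hx⟩ := IsCyclic.exists_generator (α := N)
  replace hx : ∀ g ∈ N, g ∈ Subgroup.zpowers x := fun g hg ↦ by
    obtain ⟨i, hi⟩ := Subgroup.mem_zpowers_iff.1 (hx ⟨g, hg⟩)
    exact Subgroup.mem_zpowers_iff.2 ⟨i, congrArg Subtype.val hi⟩
  obtain ⟨h, hh⟩ : ∃ h, h ∉ N := by
    by_contra! H
    exact hN.1 ((Subgroup.eq_top_iff' N).2 H)
  by_cases hxh : Commute x h
  · exact isCyclic_of_comm_of_fixedPointFree ρ hcard hfree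
      (mul_comm_of_isCoatom_of_commute hN hx hh hxh)
  exfalso
  set p := N.index
  have hfact : Fact p.Prime := ⟨hp⟩
  obtain ⟨k, hk⟩ : ∃ k : ℕ, x ^ k = h⁻¹ * x * h := by
    have hmem : h⁻¹ * x * h ∈ N := by
      simpa using Subgroup.Normal.conj_mem ‹_› x hxN h⁻¹
    exact (isOfFinOrder_of_finite x).mem_powers_iff_mem_zpowers.2 (hx _ hmem)
  have hsemi : SemiconjBy h (x ^ k) x := by
    rw [hk]
    simp [SemiconjBy, mul_assoc]
  have hpow (j : ℕ) : SemiconjBy (h ^ j) (x ^ k ^ j) x := by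
    induction j with
    | zero => simp
    | succ j ih =>
      rw [pow_succ', pow_succ, pow_mul]
      exact hsemi.mul_left (by simpa only [← pow_mul, mul_comm] using ih.pow_right k)
  obtain ⟨i, hi⟩ := Subgroup.mem_zpowers_iff.1 (hx _ (N.pow_index_mem h))
  have hxp : x ^ k ^ p = x := by
    have h1 : Commute (h ^ p) x := by
      rw [← hi]
      exact (Commute.refl x).zpow_left i
    exact mul_left_cancel ((hpow p).eq.trans h1.eq.symm)
  have hxk : x ^ k ≠ x := fun e ↦ hxh (by
    rw [e] at hsemi
    exact hsemi.eq.symm)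
  have heig {a b : ℕ} {c : K} (hc : (ρ x).HasEigenvalue c) (hab : c ^ a = c ^ b) : x ^ a = x ^ b := by
    obtain ⟨v, hv⟩ := hc.exists_hasEigenvector
    by_contra hne
    refine hv.2 (hfree ((x ^ b)⁻¹ * x ^ a) (fun e ↦ hne (inv_mul_eq_one.1 e).symm) v ?_)
    have h1 (j : ℕ) : ρ (x ^ j) v = c ^ j • v := by rw [map_pow, hv.pow_apply]
    rw [map_mul, Module.End.mul_apply, h1, hab, ← h1, ← Module.End.mul_apply, ← map_mul,
      inv_mul_cancel, map_one, Module.End.one_apply]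
  have hinj (g : G) : Function.Injective (ρ g) := by
    refine Function.LeftInverse.injective (g := ρ g⁻¹) fun v ↦ ?_
    rw [← Module.End.mul_apply, ← map_mul, inv_mul_cancel, map_one, Module.End.one_apply]
  have hper {c : K} (hc : (ρ x).HasEigenvalue c) : c ^ k ^ p = c ∧ c ^ k ≠ c := by
    refine ⟨?_, fun e ↦ hxk (by simpa using heig hc (a := k) (b := 1) (by simpa using e))⟩
    obtain ⟨v, hv⟩ := hc.exists_hasEigenvector
    refine smul_left_injective K hv.2 ?_
    change c ^ k ^ p • v = c • v
    rw [← hv.pow_apply, ← map_pow, hxp, hv.apply_eq_smul]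
  have hpn : p = n := by
    refine (Nat.prime_dvd_prime_iff_eq hp hn).1 (hV ▸ dvd_finrank_of_mul_eq_mul_pow hp (ρ x) (ρ h)
      (hinj h) k ?_ fun c hc ↦ hper hc)
    rw [← map_pow, ← map_mul, ← map_mul, hsemi.eq]
  obtain ⟨c, hc⟩ := Module.End.exists_eigenvalue (ρ x)
  obtain ⟨v, hv⟩ := hc.exists_hasEigenvector
  have hli : LinearIndependent K fun i : Fin n ↦ (ρ h ^ (i : ℕ)) v := by
    refine Module.End.eigenvectors_linearIndependent' (ρ x) (fun i : Fin n ↦ c ^ k ^ (i : ℕ)) ?_ _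
      fun j ↦ ⟨?_, fun h0 ↦ hv.2 ?_⟩
    · have hmin : Function.minimalPeriod (· ^ k) c = p :=
        Function.minimalPeriod_eq_prime (by
          rw [Function.IsPeriodicPt, Function.IsFixedPt, pow_iterate]
          exact (hper hc).1) (hper hc).2
      intro a b hab
      refine Fin.ext (Function.iterate_injOn_Iio_minimalPeriod (f := (· ^ k)) (x := c) ?_ ?_ ?_)
      · simp [hmin, hpn]
      · simp [hmin, hpn]
      · simpa only [pow_iterate] using hab
    · rw [Module.End.mem_eigenspace_iff, ← map_pow, ← Module.End.mul_apply, ← map_mul,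
        ← (hpow j).eq, map_mul, Module.End.mul_apply, map_pow ρ x, hv.pow_apply, map_smul]
    · rw [← map_pow] at h0
      exact hinj _ (h0.trans (map_zero _).symm)
  obtain ⟨j, hj⟩ : ∃ j : ℕ, x ^ j = h ^ n :=
    (isOfFinOrder_of_finite x).mem_powers_iff_mem_zpowers.2
      (hx _ (hpn ▸ N.pow_index_mem h))
  have hcp := charpoly_eq_X_pow_sub_C hV hn.ne_zero (ρ h) v (c ^ j)
    (by rw [← map_pow, ← hj, map_pow, hv.pow_apply]) hli
  have hcj : c ^ j = 1 := by
    have := LinearMap.det_eq_sign_charpoly_coeff (ρ h)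
    rw [hdet, hcp, hV, hodd.neg_one_pow] at this
    simpa [coeff_X_pow, hn.ne_zero.symm, -map_pow, coeff_C_zero] using this.symm
  have hone : (ρ h).HasEigenvalue 1 := by
    rw [Module.End.hasEigenvalue_iff_isRoot_charpoly, hcp, hcj]
    simp
  obtain ⟨w, hw⟩ := hone.exists_hasEigenvector
  exact hw.2 (hfree h (fun e ↦ hh (e ▸ N.one_mem)) w (by rw [hw.apply_eq_smul, one_smul]))

theorem isCyclic_of_fixedPointFree {K V : Type*} [Field K] [IsAlgClosed K]
    [AddCommGroup V] [Module K V] [FiniteDimensional K V] {n : ℕ} (hn : n.Prime) (hodd : Odd n)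
    (hV : Module.finrank K V = n) {G : Type*} [Group G] [Finite G] [Group.IsSolvable G]
    (ρ : G →* Module.End K V)
    (hcard : (Nat.card G : K) ≠ 0) (hfree : ∀ g ≠ 1, ∀ v, ρ g v = v → v = 0)
    (hdet : ∀ g, LinearMap.det (ρ g) = 1) : IsCyclic G := by
  induction hm : Nat.card G using Nat.strong_induction_on generalizing G with | h m ih =>
  rcases subsingleton_or_nontrivial G with hG | hG
  · infer_instance
  obtain ⟨N, hnorm, hN, hp⟩ := exists_normal_isCoatom_prime_index G
  have hlt : Nat.card N < m := by
    rw [← hm, ← N.card_mul_index]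
    exact lt_mul_of_one_lt_right Nat.card_pos hp.one_lt
  have : IsCyclic N := by
    refine ih _ hlt (ρ.comp N.subtype) (fun h0 ↦ hcard ?_)
      (fun g hg v hv ↦ hfree g (by simpa using hg) v hv) (fun g ↦ hdet g) rfl
    rw [← N.card_mul_index, Nat.cast_mul, h0, zero_mul]
  exact isCyclic_of_fixedPointFree_of_isCoatom hn hodd hV ρ hcard hfree hdet N hN hp

end

/-- If `n` is an odd prime, `K` an algebraically closed field, and `G` a finite
*solvable* subgroup of `SL(n, K)` whose order is invertible in `K`, such that `1`
is not an eigenvalue (root of the characteristic polynomial) of any matrix in `G`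
except the identity, then `G` is cyclic. -/
theorem stmt2 (n : ℕ) (hp : n.Prime) (hodd : Odd n) (K : Type*) [Field K] [IsAlgClosed K]
    (G : Subgroup (Matrix.SpecialLinearGroup (Fin n) K)) [Finite G]
    (hsolv : IsSolvable G)
    (hchar : (Nat.card G : K) ≠ 0)
    (h1 : ∀ g ∈ G, g ≠ 1 →
      Polynomial.eval 1 (Matrix.charpoly (g : Matrix (Fin n) (Fin n) K)) ≠ 0) :
    IsCyclic G := by
  have : Group.IsSolvable G := hsolv
  let ρ : G →* Module.End K (Fin n → K) :=
    (Matrix.toLinAlgEquiv' (R := K) (n := Fin n) : Matrix (Fin n) (Fin n) K →* _).comp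
      (Matrix.SpecialLinearGroup.coeMonoidHom.comp G.subtype)
  refine isCyclic_of_fixedPointFree hp hodd (Module.finrank_fin_fun K) ρ hchar ?_ ?_
  · intro g hg v hv
    by_contra hv0
    refine h1 g g.2 (by simpa using hg) ?_
    rw [← Matrix.charpoly_toLin']
    exact (Module.End.hasEigenvalue_iff_isRoot_charpoly _ _).1
      (Module.End.hasEigenvalue_of_hasEigenvector (x := v)
        ⟨Module.End.mem_eigenspace_iff.2 (hv.trans (one_smul K v).symm), hv0⟩)
  · intro g
    exact (LinearMap.det_toLin' _).trans g.1.2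
end

section
/- Let G be a finite group such that every proper subgroup of G is cyclic. Then G is solvable. -/
/-- A finite group all of whose proper subgroups are cyclic is solvable. -/
theorem stmt3 (G : Type*) [Group G] [Finite G]
    (h : ∀ H : Subgroup G, H ≠ ⊤ → IsCyclic H) :
    IsSolvable G := by
  by_cases hG : ∃ p : ℕ, p.Prime ∧ IsPGroup p G
  · obtain ⟨p, hp, hpG⟩ := hG
    have : Fact p.Prime := ⟨hp⟩
    have := hpG.isNilpotent
    exact (inferInstance : Group.IsSolvable G)
  · have : IsZGroup G := by
      refine ⟨fun p hp P => h P fun hP => hG ⟨p, hp, ?_⟩⟩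
      have hPG := P.isPGroup'
      rw [hP] at hPG
      exact hPG.of_equiv Subgroup.topEquiv
    exact (inferInstance : Group.IsSolvable G)
end

section
/- Let K be an algebraically closed field, s a positive integer invertible in K, and u an integer coprime to s whose residue class has multiplicative order d in (ℤ/sℤ)^×. Let M be a finite multiset of n elements of K, each of which is a primitive s-th root of unity, and suppose that M is equal (as a multiset) to its image under the map x ↦ x^u. Then d divides n. -/
/-- Shifting the index set `{0, …, d - 1}` by one trades the value at `0` for the value at `d`. -/
theorem Multiset.cons_map_succ_range {α : Type*} (g : ℕ → α) (d : ℕ) :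
    g 0 ::ₘ (Multiset.range d).map (fun i => g (i + 1)) = g d ::ₘ (Multiset.range d).map g := by
  induction d with
  | zero => simp
  | succ k ih =>
    rw [Multiset.range_succ, Multiset.map_cons, Multiset.map_cons, Multiset.cons_swap, ih]

/-- If every element of a multiset `M` stable under `f` has minimal period exactly `d`,
then `d` divides the cardinality of `M`. -/
theorem Multiset.dvd_card_of_map_eq_self {α : Type*} [DecidableEq α] (f : α → α) (d : ℕ)
    (hd : 0 < d) (M : Multiset α) (hf : ∀ x ∈ M, Function.minimalPeriod f x = d)
    (hM : M.map f = M) : d ∣ Multiset.card M := by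
  induction M using Multiset.strongInductionOn with
  | ih M ih =>
    rcases Multiset.empty_or_exists_mem M with rfl | ⟨x, hx⟩
    · simp
    set O : Multiset α := (Multiset.range d).map (fun i => f^[i] x) with hO
    have hOcard : Multiset.card O = d := by simp [hO]
    have hper : f^[d] x = x := by
      have := Function.iterate_minimalPeriod (f := f) (x := x)
      rwa [hf x hx] at this
    have hOnodup : O.Nodup := by
      refine Multiset.Nodup.map_on (fun i hi j hj hij => ?_) (Multiset.nodup_range d)
      have hinj := Function.iterate_injOn_Iio_minimalPeriod (f := f) (x := x)
      rw [hf x hx] at hinj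
      exact hinj (Multiset.mem_range.1 hi) (Multiset.mem_range.1 hj) hij
    have hOM : O ≤ M := by
      rw [Multiset.le_iff_subset hOnodup]
      intro y hy
      obtain ⟨i, -, rfl⟩ := Multiset.mem_map.1 hy
      clear hy
      induction i with
      | zero => exact hx
      | succ i hi =>
        rw [Function.iterate_succ_apply', ← hM]
        exact Multiset.mem_map_of_mem f hi
    have hOf : O.map f = O := by
      have h := Multiset.cons_map_succ_range (fun i => f^[i] x) d
      simp only [Function.iterate_zero, id, hper, Multiset.cons_inj_right] at h
      rw [hO, Multiset.map_map, ← h]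
      simp only [Function.comp_def, Function.iterate_succ_apply']
    obtain ⟨N, rfl⟩ := Multiset.le_iff_exists_add.1 hOM
    rw [Multiset.map_add, hOf, add_right_inj] at hM
    rw [Multiset.card_add, hOcard]
    refine (Nat.dvd_add_right dvd_rfl).2 (ih N ?_ (fun y hy => hf y (by simp [hy])) hM)
    refine lt_of_le_of_ne (Multiset.le_add_left _ _) fun h => ?_
    have := congrArg Multiset.card h
    rw [Multiset.card_add] at this
    omega

theorem iterate_zpow_apply {G : Type*} [DivisionMonoid G] (u : ℤ) (x : G) (i : ℕ) :
    (fun y : G => y ^ u)^[i] x = x ^ u ^ i := by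
  induction i with
  | zero => simp
  | succ i ih => rw [Function.iterate_succ_apply', ih, pow_succ, zpow_mul]

/-- The map `x ↦ x ^ u` has period the order of `u` modulo `s` at any primitive `s`-th root
of unity. -/
theorem IsPrimitiveRoot.minimalPeriod_zpow {K : Type*} [Field K] {s : ℕ} (hs : 0 < s) {x : K}
    (hx : IsPrimitiveRoot x s) (u : ℤ) :
    Function.minimalPeriod (fun y : K => y ^ u) x = orderOf (u : ZMod s) := by
  have key (i : ℕ) : Function.IsPeriodicPt (fun y : K => y ^ u) i x ↔ (u : ZMod s) ^ i = 1 := by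
    have hx0 : x ≠ 0 := hx.ne_zero hs.ne'
    rw [Function.IsPeriodicPt, Function.IsFixedPt, iterate_zpow_apply,
      ← sub_eq_zero (b := (1 : ZMod s))]
    have h : ((u : ZMod s) ^ i - 1) = ((u ^ i - 1 : ℤ) : ZMod s) := by push_cast; rfl
    rw [h, ZMod.intCast_zmod_eq_zero_iff_dvd, ← hx.zpow_eq_one_iff_dvd, zpow_sub₀ hx0, zpow_one,
      div_eq_one_iff_eq hx0]
  refine Nat.dvd_antisymm ?_ ?_
  · exact Function.IsPeriodicPt.minimalPeriod_dvd ((key _).2 (pow_orderOf_eq_one _))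
  · exact orderOf_dvd_of_pow_eq_one ((key _).1 (Function.isPeriodicPt_minimalPeriod _ _))


/-- Let `K` be algebraically closed, `s` a positive integer invertible in `K`,
and `u` an integer coprime to `s` whose residue class has multiplicative order `d`
in `(ℤ/sℤ)ˣ`.  If `M` is a multiset of `n` elements of `K`, each a primitive
`s`-th root of unity, which is stable (as a multiset) under `x ↦ x ^ u`,
then `d` divides `n`. -/
theorem stmt4 (K : Type*) [Field K] [IsAlgClosed K] (s : ℕ) (hs : 0 < s)
    (hsK : (s : K) ≠ 0) (u : ℤ) (hu : Int.gcd u s = 1)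
    (d : ℕ) (hd : orderOf ((u : ZMod s)) = d)
    (n : ℕ) (M : Multiset K) (hcard : Multiset.card M = n)
    (hprim : ∀ x ∈ M, IsPrimitiveRoot x s)
    (hstab : M.map (fun x => x ^ u) = M) :
    d ∣ n := by

  classical
  subst hd hcard
  have : NeZero s := ⟨hs.ne'⟩
  have hunit : IsUnit (u : ZMod s) := by
    rw [ZMod.coe_int_isUnit_iff_isCoprime]
    exact (Int.isCoprime_iff_gcd_eq_one.2 hu).symm
  have hpos : 0 < orderOf (u : ZMod s) := by
    obtain ⟨v, hv⟩ := hunit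
    rw [← hv, orderOf_units]
    exact orderOf_pos v
  exact Multiset.dvd_card_of_map_eq_self _ _ hpos M
    (fun x hx => (hprim x hx).minimalPeriod_zpow hs u) hstab
end

section
/- Let K be a field, n ≥ 1, and let b be the n × n matrix over K whose only possibly nonzero entries are b(0, n−1) = b₀ and b(i, i−1) = bᵢ for i = 1, …, n−1. Then the characteristic polynomial of b equals X^n − b₀b₁⋯b_{n−1}. -/
/-- Let `b` be the `n × n` matrix whose only possibly nonzero entries are
`b (0, n-1) = c 0` and `b (i, i-1) = c i` for `i = 1, …, n-1`.  Then the
characteristic polynomial of `b` is `X ^ n - c 0 * c 1 * ⋯ * c (n-1)`. -/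
theorem stmt5 (K : Type*) [Field K] (n : ℕ) (hn : 1 ≤ n) (c : Fin n → K)
    (b : Matrix (Fin n) (Fin n) K)
    (hb : ∀ i j : Fin n, b i j =
      if (i : ℕ) = 0 ∧ (j : ℕ) = n - 1 then c ⟨0, hn⟩
      else if (j : ℕ) + 1 = (i : ℕ) then c i else 0) :
    Matrix.charpoly b = Polynomial.X ^ n - Polynomial.C (∏ i, c i) := by
  obtain ⟨m, rfl⟩ : ∃ m, n = m + 1 := ⟨n - 1, by omega⟩
  cases m with
  | zero => simp [Matrix.charpoly, Matrix.charmatrix, hb]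
  | succ k =>
    have first : (b.charmatrix.submatrix Fin.succ (Fin.succAbove 0)).det
        = Polynomial.X ^ (k + 1) := by
      rw [Matrix.det_of_isLowerTriangular]
      · simp [hb]
      · intro i j hij
        have hij : i < j := hij
        have hne : i.succ ≠ j.succ := by simpa using hij.ne
        have hlt : (i : ℕ) < j := hij
        simp only [Matrix.submatrix_apply, Fin.zero_succAbove,
          Matrix.charmatrix_apply_ne _ _ _ hne, hb]
        rw [if_neg (by simp), if_neg (by simp only [Fin.val_succ]; omega)]
        simp
    have last : (b.charmatrix.submatrix Fin.succ (Fin.succAbove (Fin.last (k + 1)))).det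
        = (-1) ^ (k + 1) * ∏ i : Fin (k + 1), Polynomial.C (c i.succ) := by
      rw [Matrix.det_of_isUpperTriangular]
      · have key (i : Fin (k + 1)) : b.charmatrix i.succ i.castSucc
            = -Polynomial.C (c i.succ) := by
          rw [Matrix.charmatrix_apply_ne _ _ _ (Fin.castSucc_lt_succ).ne', hb,
            if_neg (by simp), if_pos (by simp)]
        simp [key, Finset.prod_neg]
      · intro i j hij
        have hlt : (j : ℕ) < i := hij
        have hne : i.succ ≠ j.castSucc := by
          intro h
          have := congrArg Fin.val h
          simp only [Fin.val_succ, Fin.val_castSucc] at this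
          omega
        simp only [Matrix.submatrix_apply, Fin.succAbove_last,
          Matrix.charmatrix_apply_ne _ _ _ hne, hb]
        rw [if_neg (by simp), if_neg (by simp only [Fin.val_succ, Fin.val_castSucc]; omega)]
        simp
    have corner : b.charmatrix 0 0 = Polynomial.X := by
      simp [hb]
    have end_entry : b.charmatrix 0 (Fin.last (k + 1)) = -Polynomial.C (c 0) := by
      rw [Matrix.charmatrix_apply_ne _ _ _ (Fin.last_pos).ne, hb, if_pos (by simp)]
      rfl
    have sq : ((-1 : Polynomial K) ^ (k + 1)) * (-1) ^ (k + 1) = 1 := by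
      rw [← mul_pow]; simp
    rw [Matrix.charpoly, Matrix.det_succ_row_zero,
      Finset.sum_eq_add (0 : Fin (k + 2)) (Fin.last (k + 1)) (Fin.last_pos).ne ?_
        (by simp) (by simp), first, last, corner, end_entry, map_prod,
      Fin.prod_univ_succ (n := k + 1) (fun i => Polynomial.C (c i)),
      Fin.val_last, Fin.val_zero]
    · linear_combination
        (-Polynomial.C (c 0) * ∏ i : Fin (k + 1), Polynomial.C (c i.succ)) * sq
    · rintro j - ⟨h0, hl⟩
      have hval : (j : ℕ) ≠ k + 1 := fun h => hl (Fin.ext h)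
      have : b.charmatrix 0 j = 0 := by
        rw [Matrix.charmatrix_apply_ne _ _ _ h0.symm, hb, if_neg (by simpa using hval),
          if_neg (by simp)]
        simp
      simp [this]
end

section
/- Let n be an even positive integer. Then there exists a finite non-abelian subgroup G of SL(n, ℂ) such that 1 is not an eigenvalue of any matrix in G except the identity matrix. -/
open Matrix in
/-- The quaternion group of order eight, as the group of all matrices of determinant one that are
diagonal or antidiagonal with fourth roots of unity as nonzero entries. -/
def quaternionSubgroup : Subgroup (SpecialLinearGroup (Fin 2) ℂ) where
  carrier := {A | (A 0 1 = 0 ∧ A 1 0 = 0 ∧ A 0 0 ^ 4 = 1 ∧ A 1 1 ^ 4 = 1) ∨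
    (A 0 0 = 0 ∧ A 1 1 = 0 ∧ A 0 1 ^ 4 = 1 ∧ A 1 0 ^ 4 = 1)}
  one_mem' := by simp
  mul_mem' := by
    rintro A B (⟨h1, h2, h3, h4⟩ | ⟨h1, h2, h3, h4⟩) (⟨k1, k2, k3, k4⟩ | ⟨k1, k2, k3, k4⟩) <;>
    simp [Matrix.mul_apply, Fin.sum_univ_two, mul_pow, *]
  inv_mem' := by
    rintro A (⟨h1, h2, h3, h4⟩ | ⟨h1, h2, h3, h4⟩) <;>
    simp [adjugate_fin_two, Even.neg_pow (by decide : Even 4), *]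

theorem finite_quaternionSubgroup : Finite quaternionSubgroup := by
  have hS : {z : ℂ | z = 0 ∨ z ^ 4 = 1}.Finite := by
    refine ((Polynomial.X * (Polynomial.X ^ 4 - 1) : Polynomial ℂ).rootSet_finite ℂ).subset ?_
    intro z hz
    rw [Polynomial.mem_rootSet]
    refine ⟨mul_ne_zero Polynomial.X_ne_zero (Polynomial.X_pow_sub_C_ne_zero (by norm_num) 1), ?_⟩
    rcases hz with rfl | hz <;> simp [*]
  have := hS.to_subtype
  let f : quaternionSubgroup → Fin 2 → Fin 2 → {z : ℂ | z = 0 ∨ z ^ 4 = 1} := fun A i j =>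
    ⟨A.1 i j, by
      obtain ⟨A, ⟨h1, h2, h3, h4⟩ | ⟨h1, h2, h3, h4⟩⟩ := A <;>
      fin_cases i <;> fin_cases j <;> simp [*]⟩
  refine Finite.of_injective f fun A B h => Subtype.ext (Matrix.SpecialLinearGroup.ext _ _ ?_)
  exact fun i j => congrArg Subtype.val (congrFun (congrFun h i) j)

theorem det_one_sub_ne_zero_of_mem_quaternionSubgroup
    {A : Matrix.SpecialLinearGroup (Fin 2) ℂ} (hA : A ∈ quaternionSubgroup) (h : A ≠ 1) :
    (1 - (A : Matrix (Fin 2) (Fin 2) ℂ)).det ≠ 0 := by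
  intro h0
  have hdet := A.det_coe
  rw [Matrix.det_fin_two] at hdet h0
  simp only [Matrix.sub_apply, Matrix.one_apply_eq, ne_eq, zero_ne_one, one_ne_zero,
    not_false_eq_true, Matrix.one_apply_ne] at h0
  rcases hA with ⟨h1, h2, -⟩ | ⟨h1, h2, -⟩
  · rw [h1, h2] at h0 hdet
    have ha : A 0 0 = 1 := by
      have : (A 0 0 - 1) ^ 2 = 0 := by linear_combination -A 0 0 * h0 + (A 0 0 - 1) * hdet
      exact sub_eq_zero.mp (pow_eq_zero_iff two_ne_zero |>.mp this)
    have hd : A 1 1 = 1 := by rw [ha] at hdet; linear_combination hdet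
    apply h
    ext i j
    fin_cases i <;> fin_cases j <;> simp [*]
  · rw [h1, h2] at h0 hdet
    have : (2 : ℂ) = 0 := by linear_combination h0 - hdet
    norm_num at this

/-- The block diagonal embedding of `SL(k, R)` along an identification of index types. -/
def Matrix.SpecialLinearGroup.blockDiagonalHom {k m n R : Type*} [DecidableEq k] [Fintype k]
    [DecidableEq m] [Fintype m] [DecidableEq n] [Fintype n] [CommRing R] (e : k × m ≃ n) :
    Matrix.SpecialLinearGroup k R →* Matrix.SpecialLinearGroup n R where
  toFun A := ⟨Matrix.reindex e e (Matrix.blockDiagonal fun _ => (A : Matrix k k R)), by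
    simp [Matrix.det_blockDiagonal]⟩
  map_one' := by
    apply Subtype.ext
    change Matrix.reindex e e (Matrix.blockDiagonal 1) = 1
    simp
  map_mul' A B := by
    apply Subtype.ext
    change Matrix.reindex e e
        (Matrix.blockDiagonal fun _ => (A : Matrix k k R) * (B : Matrix k k R)) =
      Matrix.reindex e e (Matrix.blockDiagonal fun _ => (A : Matrix k k R)) *
        Matrix.reindex e e (Matrix.blockDiagonal fun _ => (B : Matrix k k R))
    simp [Matrix.blockDiagonal_mul, Matrix.submatrix_mul_equiv]

theorem Matrix.SpecialLinearGroup.blockDiagonalHom_injective {k m n R : Type*} [DecidableEq k]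
    [Fintype k] [DecidableEq m] [Fintype m] [Nonempty m] [DecidableEq n] [Fintype n] [CommRing R]
    (e : k × m ≃ n) :
    Function.Injective (Matrix.SpecialLinearGroup.blockDiagonalHom (R := R) e) := by
  intro A B h
  have h' := Matrix.blockDiagonal_injective ((Matrix.reindex e e).injective (congrArg Subtype.val h))
  exact Subtype.ext (congrFun h' (Classical.arbitrary m))

theorem Matrix.SpecialLinearGroup.eval_one_charpoly_blockDiagonalHom {k m n R : Type*}
    [DecidableEq k] [Fintype k] [DecidableEq m] [Fintype m] [DecidableEq n] [Fintype n]
    [CommRing R] (e : k × m ≃ n) (A : Matrix.SpecialLinearGroup k R) :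
    Polynomial.eval 1 (Matrix.charpoly
      (Matrix.SpecialLinearGroup.blockDiagonalHom e A : Matrix n n R)) =
      (1 - (A : Matrix k k R)).det ^ Fintype.card m := by
  change Polynomial.eval 1 (Matrix.charpoly (Matrix.reindex e e
    (Matrix.blockDiagonal fun _ => (A : Matrix k k R)))) = _
  rw [Matrix.charpoly_reindex, Matrix.eval_charpoly, map_one, ← Matrix.blockDiagonal_one,
    ← Matrix.blockDiagonal_sub, Matrix.det_blockDiagonal]
  simp

theorem not_commute_quaternionSubgroup :
    ∃ A ∈ quaternionSubgroup, ∃ B ∈ quaternionSubgroup, A * B ≠ B * A := by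
  refine ⟨⟨!![Complex.I, 0; 0, -Complex.I], by simp [Matrix.det_fin_two]⟩,
    Or.inl (by simp [Even.neg_pow (by decide : Even 4)]),
    ⟨!![0, 1; -1, 0], by simp [Matrix.det_fin_two]⟩,
    Or.inr (by simp [Even.neg_pow (by decide : Even 4)]), fun h => ?_⟩
  have h01 : (!![Complex.I, 0; 0, -Complex.I] * !![0, 1; -1, 0] : Matrix (Fin 2) (Fin 2) ℂ) 0 1 =
      (!![0, 1; -1, 0] * !![Complex.I, 0; 0, -Complex.I] : Matrix (Fin 2) (Fin 2) ℂ) 0 1 :=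
    congrFun (congrFun (congrArg Subtype.val h) 0) 1
  simp [Matrix.mul_apply, Fin.sum_univ_two, self_eq_neg] at h01

/-- If `n` is an even positive integer, then there exists a finite non-abelian
subgroup `G` of `SL(n, ℂ)` such that `1` is not an eigenvalue (root of the
characteristic polynomial) of any matrix in `G` except the identity. -/
theorem stmt8 (n : ℕ) (hn : 0 < n) (heven : Even n) :
    ∃ G : Subgroup (Matrix.SpecialLinearGroup (Fin n) ℂ),
      Finite G ∧
      ¬ (∀ a ∈ G, ∀ b ∈ G, a * b = b * a) ∧
      ∀ g ∈ G, g ≠ 1 →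
        Polynomial.eval 1 (Matrix.charpoly (g : Matrix (Fin n) (Fin n) ℂ)) ≠ 0 := by
  obtain ⟨m, rfl⟩ := heven
  have : Nonempty (Fin m) := ⟨⟨0, by omega⟩⟩
  let e : Fin 2 × Fin m ≃ Fin (m + m) := finProdFinEquiv.trans (finCongr (two_mul m))
  have hfin := finite_quaternionSubgroup
  refine ⟨quaternionSubgroup.map (Matrix.SpecialLinearGroup.blockDiagonalHom e), ?_, ?_, ?_⟩
  · exact Set.Finite.to_subtype (Set.Finite.image _ (Set.toFinite
      (quaternionSubgroup : Set (Matrix.SpecialLinearGroup (Fin 2) ℂ))))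
  · intro h
    obtain ⟨A, hA, B, hB, hAB⟩ := not_commute_quaternionSubgroup
    apply hAB
    apply Matrix.SpecialLinearGroup.blockDiagonalHom_injective e
    rw [map_mul, map_mul]
    exact h _ (Subgroup.mem_map_of_mem _ hA) _ (Subgroup.mem_map_of_mem _ hB)
  · rintro _ ⟨A, hA, rfl⟩ hne
    rw [Matrix.SpecialLinearGroup.eval_one_charpoly_blockDiagonalHom]
    refine pow_ne_zero _ (det_one_sub_ne_zero_of_mem_quaternionSubgroup hA ?_)
    rintro rfl
    exact hne (map_one _)
end

section
/- Let q be an odd prime, l a prime with l ≡ 1 (mod 2q), α an integer whose residue class has multiplicative order q in (ℤ/lℤ)^×, z a primitive l-th root of unity in ℂ, and x a primitive q-th root of unity in ℂ. Let A be the q × q complex matrix whose only nonzero entries are A(0, q−1) = x and A(i, i−1) = 1 for i = 1, …, q−1, and let B be the diagonal matrix with diagonal entries z^{α⁰}, z^{α¹}, …, z^{α^{q−1}}. Then A⁻¹BA = B^α; in particular AB ≠ BA, so the group ⟨A, B⟩ is not abelian. -/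
theorem IsPrimitiveRoot.zpow_eq_zpow_iff_intCast_eq {K : Type*} [Field K] {z : K} {l : ℕ}
    (hz : IsPrimitiveRoot z l) (hl : l ≠ 0) (a b : ℤ) :
    z ^ a = z ^ b ↔ (a : ZMod l) = b := by
  have hz0 : z ≠ 0 := hz.ne_zero hl
  rw [eq_comm (a := (a : ZMod l)), ZMod.intCast_eq_intCast_iff_dvd_sub, ← hz.zpow_eq_one_iff_dvd,
    zpow_sub₀ hz0, div_eq_one_iff_eq (zpow_ne_zero _ hz0)]

theorem Matrix.diagonal_zpow_of_ne_zero {n K : Type*} [Fintype n] [DecidableEq n] [Field K]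
    (d : n → K) (hd : ∀ i, d i ≠ 0) (a : ℤ) :
    Matrix.diagonal d ^ a = Matrix.diagonal (fun i => d i ^ a) := by
  cases a with
  | ofNat m => simp [Matrix.diagonal_pow, Pi.pow_def]
  | negSucc m =>
    rw [zpow_negSucc, Matrix.diagonal_pow]
    refine Matrix.inv_eq_right_inv ?_
    rw [Matrix.diagonal_mul_diagonal, ← Matrix.diagonal_one]
    congr 1
    ext i
    simp [zpow_negSucc, hd i]

/-- A monomial matrix supported on a permutation, with nonzero entries there, is invertible. -/
theorem Matrix.isUnit_det_diagonal_submatrix {n K : Type*} [Fintype n] [DecidableEq n] [Field K]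
    (d : n → K) (hd : ∀ i, d i ≠ 0) (e : n ≃ n) :
    IsUnit ((Matrix.diagonal d).submatrix id e).det := by
  rw [Matrix.det_permute', Matrix.det_diagonal, isUnit_iff_ne_zero]
  exact mul_ne_zero (by rcases Int.units_eq_one_or (Equiv.Perm.sign e) with h | h <;> simp [h])
    (Finset.prod_ne_zero_iff.2 fun i _ => hd i)


/-- With `A`, `B` as in the setup of Section 3.2 (`q` an odd prime, `l` a prime
with `l ≡ 1 (mod 2q)`, `α` of multiplicative order `q` mod `l`, `z` a primitive
`l`-th root of unity, `x` a primitive `q`-th root of unity), we have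
`A⁻¹ * B * A = B ^ α`; in particular `A * B ≠ B * A`, so `⟨A, B⟩` is not
abelian. -/
theorem stmt10 (q : ℕ) (hq : q.Prime) (hqodd : Odd q)
    (l : ℕ) (hl : l.Prime) (hl1 : l % (2 * q) = 1)
    (α : ℤ) (hα : orderOf ((α : ZMod l)) = q)
    (z x : ℂ) (hz : IsPrimitiveRoot z l) (hx : IsPrimitiveRoot x q)
    (A B : Matrix (Fin q) (Fin q) ℂ)
    (hA : ∀ i j : Fin q, A i j =
      if (i : ℕ) = 0 ∧ (j : ℕ) = q - 1 then x
      else if (j : ℕ) + 1 = (i : ℕ) then 1 else 0)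
    (hB : B = Matrix.diagonal (fun i : Fin q => z ^ α ^ (i : ℕ))) :
    A⁻¹ * B * A = B ^ α ∧ A * B ≠ B * A := by
  have hz0 : z ≠ 0 := hz.ne_zero hl.ne_zero
  have hx0 : x ≠ 0 := hx.ne_zero hq.ne_zero
  have hq2 : 2 ≤ q := hq.two_le
  have hαq : (α : ZMod l) ^ q = 1 := hα ▸ pow_orderOf_eq_one _
  have hdet : IsUnit A.det := by
    obtain ⟨n, rfl⟩ : ∃ n, q = n + 1 := ⟨q - 1, by omega⟩
    have hA' : A = (Matrix.diagonal fun i : Fin (n + 1) => if i = 0 then x else 1).submatrix id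
        (Equiv.addRight 1) := by
      ext i j
      simp only [hA, Matrix.submatrix_apply, id, Matrix.diagonal_apply, Equiv.coe_addRight,
        Fin.ext_iff, Fin.val_add_one, Fin.val_last, Fin.val_zero]
      grind
    rw [hA']
    exact Matrix.isUnit_det_diagonal_submatrix _ (fun i => by split_ifs <;> simp [hx0]) _
  have hBα : B ^ α = Matrix.diagonal fun i : Fin q => z ^ α ^ ((i : ℕ) + 1) := by
    rw [hB, Matrix.diagonal_zpow_of_ne_zero _ fun i => zpow_ne_zero _ hz0]
    simp only [← zpow_mul, pow_succ]
  have hBA : B * A = A * B ^ α := by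
    ext i j
    rw [hBα, hB, Matrix.diagonal_mul, Matrix.mul_diagonal, hA]
    split_ifs with h h'
    · have : z ^ α ^ (i : ℕ) = z ^ α ^ ((j : ℕ) + 1) := by
        rw [hz.zpow_eq_zpow_iff_intCast_eq hl.ne_zero, h.1, h.2, Nat.sub_add_cancel hq.one_le]
        simp [hαq]
      rw [this, mul_comm]
    · rw [h', mul_comm]
    · simp
  refine ⟨by rw [mul_assoc, hBA, Matrix.nonsing_inv_mul_cancel_left _ _ hdet], fun h => ?_⟩
  have h10 := congr_fun (congr_fun h ⟨1, hq2⟩) ⟨0, hq.pos⟩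
  rw [hB, Matrix.diagonal_mul, Matrix.mul_diagonal, hA] at h10
  simp only [one_ne_zero, false_and, if_false, zero_add, if_true, one_mul, mul_one] at h10
  rw [hz.zpow_eq_zpow_iff_intCast_eq hl.ne_zero] at h10
  simp only [pow_zero, pow_one, Int.cast_one] at h10
  rw [← h10, orderOf_one] at hα
  omega
end

section
/- Let q be an odd prime, l a prime with l ≡ 1 (mod 2q), α an integer whose residue class has multiplicative order q in (ℤ/lℤ)^×, z a primitive l-th root of unity in ℂ, and x a primitive q-th root of unity in ℂ. Let A be the q × q complex matrix whose only nonzero entries are A(0, q−1) = x and A(i, i−1) = 1 for i = 1, …, q−1, and let B be the diagonal matrix with diagonal entries z^{α⁰}, z^{α¹}, …, z^{α^{q−1}}. Then the order of A is q², the order of B is l, every element of ⟨A, B⟩ has the form A^r B^s with 0 ≤ r < q² and 0 ≤ s < l, and in particular the group ⟨A, B⟩ is finite. -/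
/-- Entries of the powers of a twisted cyclic shift matrix. -/
theorem twistedShift_pow_apply {R : Type*} [CommSemiring R] {q : ℕ} (hq : 1 < q) (x : R)
    (A : Matrix (Fin q) (Fin q) R)
    (hA : ∀ i j : Fin q, A i j =
      if (i : ℕ) = 0 ∧ (j : ℕ) = q - 1 then x
      else if (j : ℕ) + 1 = (i : ℕ) then 1 else 0)
    (k : ℕ) (hk : k ≤ q) (i j : Fin q) :
    (A ^ k) i j = if (j : ℕ) + k = i then 1 else if (j : ℕ) + k = i + q then x else 0 := by
  induction k generalizing i j with
  | zero =>
    have h : ¬ (j : ℕ) = i + q := by omega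
    simp [Matrix.one_apply, Fin.ext_iff, h, eq_comm]
  | succ k ih =>
    rw [pow_succ, Matrix.mul_apply]
    have ih' := ih (by omega)
    by_cases hj : (j : ℕ) + 1 < q
    · rw [Finset.sum_eq_single (⟨j + 1, hj⟩ : Fin q)]
      · rw [ih', hA]
        have h : ¬ (j : ℕ) = q - 1 := by omega
        simp [add_assoc, add_comm 1 k]
      · intro m _ hm
        have hm' : ¬ (j : ℕ) + 1 = m := fun h => hm (Fin.ext h.symm)
        have h : ¬ (j : ℕ) = q - 1 := by omega
        simp [hA, hm', h]
      · simp
    · have hj' : (j : ℕ) = q - 1 := by omega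
      rw [Finset.sum_eq_single (⟨0, by omega⟩ : Fin q)]
      · rw [ih']
        have h1 : ¬ k = (i : ℕ) + q := by omega
        have h2 : ¬ (j : ℕ) + (k + 1) = i := by omega
        have h3 : (j : ℕ) + (k + 1) = i + q ↔ k = i := by omega
        have hAj : A ⟨0, by omega⟩ j = x := by simp [hA, hj']
        simp only [h2, h3, zero_add, h1, if_false]
        rw [hAj]
        split_ifs <;> simp
      · intro m _ hm
        have hm' : ¬ (m : ℕ) = 0 := fun h => hm (Fin.ext h)
        have h : ¬ (j : ℕ) + 1 = m := by omega
        simp [hA, hm', h]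
      · simp

/-- The `q`-th power of a twisted cyclic shift matrix is scalar. -/
theorem twistedShift_pow_eq_smul_one {R : Type*} [CommSemiring R] {q : ℕ} (hq : 1 < q) (x : R)
    (A : Matrix (Fin q) (Fin q) R)
    (hA : ∀ i j : Fin q, A i j =
      if (i : ℕ) = 0 ∧ (j : ℕ) = q - 1 then x
      else if (j : ℕ) + 1 = (i : ℕ) then 1 else 0) :
    A ^ q = x • (1 : Matrix (Fin q) (Fin q) R) := by
  ext i j
  rw [twistedShift_pow_apply hq x A hA q le_rfl]
  have h : ¬ (j : ℕ) + q = i := by omega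
  simp [h, Matrix.one_apply, Fin.ext_iff, eq_comm]

/-- If `b * a = a * b ^ n` with `a`, `b` of finite order, then every element of the subgroup
generated by `a` and `b` is a reduced product `a ^ r * b ^ s`. -/
theorem Subgroup.exists_pow_mul_pow_of_mem_closure_pair {G : Type*} [Group G] {a b : G} {n : ℤ}
    (ha : 0 < orderOf a) (hb : 0 < orderOf b) (hab : b * a = a * b ^ n) {g : G}
    (hg : g ∈ Subgroup.closure {a, b}) :
    ∃ r s : ℕ, r < orderOf a ∧ s < orderOf b ∧ g = a ^ r * b ^ s := by
  have hconj : a⁻¹ * b * a = b ^ n := by rw [mul_assoc, hab, inv_mul_cancel_left]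
  have hzpow (s : ℤ) : b ^ s * a = a * b ^ (n * s) := by
    have h := conj_zpow (i := s) (a := a⁻¹) (b := b)
    rw [inv_inv, hconj, ← zpow_mul] at h
    rw [h, mul_assoc, mul_inv_cancel_left]
  have hpow (k : ℕ) (s : ℤ) : b ^ s * a ^ k = a ^ k * b ^ (n ^ k * s) := by
    induction k with
    | zero => simp
    | succ k ih => rw [pow_succ, ← mul_assoc, ih, mul_assoc, hzpow, ← mul_assoc, pow_succ' n,
        mul_assoc n]
  have hinv : a⁻¹ = a ^ (orderOf a - 1) :=
    inv_eq_of_mul_eq_one_right (by rw [← pow_succ', Nat.sub_add_cancel ha, pow_orderOf_eq_one])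
  have key : ∃ (r : ℕ) (s : ℤ), g = a ^ r * b ^ s := by
    induction hg using Subgroup.closure_induction_right with
    | one => exact ⟨0, 0, by simp⟩
    | mul_right u _ y hy ih =>
      obtain ⟨r, s, rfl⟩ := ih
      rcases hy with rfl | rfl
      · exact ⟨r + 1, n * s, by rw [mul_assoc, hzpow, ← mul_assoc, pow_succ]⟩
      · exact ⟨r, s + 1, by rw [mul_assoc, zpow_add_one]⟩
    | mul_inv_cancel u _ y hy ih =>
      obtain ⟨r, s, rfl⟩ := ih
      rcases hy with rfl | rfl
      · exact ⟨r + (orderOf y - 1), n ^ (orderOf y - 1) * s, by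
          rw [hinv, mul_assoc, hpow, ← mul_assoc, pow_add]⟩
      · exact ⟨r, s - 1, by rw [mul_assoc, zpow_sub_one]⟩
  obtain ⟨r, s, rfl⟩ := key
  have hs0 : 0 ≤ s % (orderOf b : ℤ) := Int.emod_nonneg _ (by omega)
  have hs1 : s % (orderOf b : ℤ) < orderOf b := Int.emod_lt_of_pos _ (by omega)
  refine ⟨r % orderOf a, (s % (orderOf b : ℤ)).toNat, Nat.mod_lt _ ha, by omega, ?_⟩
  rw [pow_mod_orderOf, ← zpow_natCast b, Int.toNat_of_nonneg hs0, zpow_mod_orderOf]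


/-- With `A`, `B` as in the setup of Section 3.2, regarded as elements `A'`, `B'`
of `GL(q, ℂ)`: the order of `A'` is `q ^ 2`, the order of `B'` is `l`, every
element of `⟨A', B'⟩` is of the form `A' ^ r * B' ^ s` with `0 ≤ r < q ^ 2` and
`0 ≤ s < l`; in particular the group `⟨A', B'⟩` is finite. -/
theorem stmt11 (q : ℕ) (hq : q.Prime) (hqodd : Odd q)
    (l : ℕ) (hl : l.Prime) (hl1 : l % (2 * q) = 1)
    (α : ℤ) (hα : orderOf ((α : ZMod l)) = q)
    (z x : ℂ) (hz : IsPrimitiveRoot z l) (hx : IsPrimitiveRoot x q)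
    (A B : Matrix (Fin q) (Fin q) ℂ)
    (hA : ∀ i j : Fin q, A i j =
      if (i : ℕ) = 0 ∧ (j : ℕ) = q - 1 then x
      else if (j : ℕ) + 1 = (i : ℕ) then 1 else 0)
    (hB : B = Matrix.diagonal (fun i : Fin q => z ^ α ^ (i : ℕ)))
    (A' B' : GL (Fin q) ℂ)
    (hA' : (A' : Matrix (Fin q) (Fin q) ℂ) = A)
    (hB' : (B' : Matrix (Fin q) (Fin q) ℂ) = B) :
    orderOf A' = q ^ 2 ∧ orderOf B' = l ∧
    (∀ g ∈ Subgroup.closure {A', B'}, ∃ r s : ℕ,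
      r < q ^ 2 ∧ s < l ∧ g = A' ^ r * B' ^ s) ∧
    Finite (Subgroup.closure {A', B'} : Subgroup (GL (Fin q) ℂ)) := by
  have hq1 : 1 < q := hq.one_lt
  have hAq : A ^ q = x • (1 : Matrix (Fin q) (Fin q) ℂ) :=
    twistedShift_pow_eq_smul_one hq1 x A hA
  have hordA : orderOf A' = q ^ 2 := by
    have : Fact q.Prime := ⟨hq⟩
    refine orderOf_eq_prime_pow (n := 1) (fun h => ?_) ?_
    · have h' := congrArg (fun M : GL (Fin q) ℂ => (M : Matrix (Fin q) (Fin q) ℂ)) h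
      simp only [pow_one, Units.val_pow_eq_pow_val, hA', hAq, Units.val_one] at h'
      have h0 := congrFun (congrFun h' ⟨0, hq.pos⟩) ⟨0, hq.pos⟩
      exact hx.ne_one hq1 (by simpa using h0)
    · apply Units.ext
      rw [Units.val_pow_eq_pow_val, hA', pow_succ, pow_one, pow_mul, hAq, smul_pow, hx.pow_eq_one,
        one_pow, one_smul, Units.val_one]
  have hz0 : z ≠ 0 := hz.ne_zero hl.ne_zero
  have hordB : orderOf B' = l := by
    have : Fact l.Prime := ⟨hl⟩
    refine orderOf_eq_prime ?_ (fun h => ?_)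
    · apply Units.ext
      rw [Units.val_pow_eq_pow_val, hB', hB, Matrix.diagonal_pow, Units.val_one,
        ← Matrix.diagonal_one]
      congr 1
      funext i
      rw [Pi.pow_apply, ← zpow_natCast, zpow_comm, zpow_natCast, hz.pow_eq_one, one_zpow]
    · have h' : B = 1 := by rw [← hB', h, Units.val_one]
      have h0 := congrFun (congrFun h' ⟨0, hq.pos⟩) ⟨0, hq.pos⟩
      exact hz.ne_one hl.one_lt (by simpa [hB] using h0)
  have hzα : z ^ α ^ q = z := by
    have h1 : ((α ^ q - 1 : ℤ) : ZMod l) = 0 := by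
      push_cast
      rw [← hα, pow_orderOf_eq_one, sub_self]
    have h2 := (hz.zpow_eq_one_iff_dvd _).2 ((ZMod.intCast_zmod_eq_zero_iff_dvd _ _).1 h1)
    rw [zpow_sub_one₀ hz0] at h2
    exact (mul_inv_eq_one₀ hz0).1 h2
  obtain ⟨n, hn⟩ : ∃ n : ℕ, (n : ℤ) ≡ α [ZMOD l] := by
    have hl0 : (l : ℤ) ≠ 0 := by exact_mod_cast hl.ne_zero
    exact ⟨(α % l).toNat, by
      rw [Int.toNat_of_nonneg (Int.emod_nonneg _ hl0)]; exact Int.mod_modEq _ _⟩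
  have hzn : z ^ n = z ^ α := by
    have h2 := (hz.zpow_eq_one_iff_dvd _).2 hn.symm.dvd
    rw [zpow_sub₀ hz0, div_eq_one_iff_eq (zpow_ne_zero _ hz0), zpow_natCast] at h2
    exact h2
  have hcomm : B' * A' = A' * B' ^ (n : ℤ) := by
    apply Units.ext
    rw [zpow_natCast, Units.val_mul, Units.val_mul, Units.val_pow_eq_pow_val, hA', hB', hB,
      Matrix.diagonal_pow]
    ext i j
    rw [Matrix.diagonal_mul, Matrix.mul_diagonal, hA, Pi.pow_apply]
    have hstep : (z ^ α ^ (j : ℕ)) ^ n = z ^ α ^ ((j : ℕ) + 1) := by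
      rw [← zpow_natCast, zpow_comm, zpow_natCast, hzn, ← zpow_mul, pow_succ']
    rw [hstep]
    split_ifs with h1 h2
    · rw [h1.1, h1.2, Nat.sub_add_cancel hq.one_le, hzα, pow_zero, zpow_one, mul_comm]
    · rw [h2, mul_comm]
    · simp
  have hform : ∀ g ∈ Subgroup.closure {A', B'}, ∃ r s : ℕ,
      r < q ^ 2 ∧ s < l ∧ g = A' ^ r * B' ^ s := by
    intro g hg
    rw [← hordA, ← hordB]
    exact Subgroup.exists_pow_mul_pow_of_mem_closure_pair (hordA ▸ pow_pos hq.pos 2)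
      (hordB ▸ hl.pos) hcomm hg
  refine ⟨hordA, hordB, hform, ?_⟩
  refine Set.Finite.subset (((Set.finite_Iio (q ^ 2)).prod (Set.finite_Iio l)).image
    fun p : ℕ × ℕ => A' ^ p.1 * B' ^ p.2) (fun g hg => ?_)
  obtain ⟨r, s, hr, hs, rfl⟩ := hform g hg
  exact ⟨(r, s), ⟨hr, hs⟩, rfl⟩
end

section
/- Let q be an odd prime, l a prime with l ≡ 1 (mod 2q), α an integer whose residue class has multiplicative order q in (ℤ/lℤ)^×, z a primitive l-th root of unity in ℂ, and x a primitive q-th root of unity in ℂ. Let A be the q × q complex matrix whose only nonzero entries are A(0, q−1) = x and A(i, i−1) = 1 for i = 1, …, q−1, and let B be the diagonal matrix with diagonal entries z^{α⁰}, z^{α¹}, …, z^{α^{q−1}}. Then 1 is not an eigenvalue of any matrix in the group ⟨A, B⟩ except the identity matrix. -/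
/-- If `B * A = A * B ^ α`, powers of `A` move past powers of `B` by raising the latter to a power
of `α`. -/
theorem zpow_mul_pow_of_mul_eq {G : Type*} [Group G] {A B : G} {α : ℤ} (h : B * A = A * B ^ α)
    (a : ℤ) (k : ℕ) : B ^ a * A ^ k = A ^ k * B ^ (a * α ^ k) := by
  have h1 : ∀ a : ℤ, B ^ a * A = A * B ^ (a * α) := fun a => by
    have h2 : SemiconjBy A (B ^ α) B := h.symm
    have h3 := (h2.zpow_right a).eq
    rw [← zpow_mul, mul_comm α] at h3
    exact h3.symm
  induction k with
  | zero => simp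
  | succ k ih => rw [pow_succ, ← mul_assoc, ih, mul_assoc, h1, ← mul_assoc, mul_assoc a,
      ← pow_succ, ← pow_succ]

/-- Powers of `A ^ k * B ^ a` when `B * A = A * B ^ α`. -/
theorem pow_mul_zpow_pow_of_mul_eq {G : Type*} [Group G] {A B : G} {α : ℤ}
    (h : B * A = A * B ^ α) (a : ℤ) (k n : ℕ) :
    (A ^ k * B ^ a) ^ n = A ^ (k * n) * B ^ (a * ∑ i ∈ Finset.range n, (α ^ k) ^ i) := by
  induction n with
  | zero => simp
  | succ n ih =>
    rw [pow_succ, ih, mul_assoc, ← mul_assoc (B ^ _), zpow_mul_pow_of_mul_eq h, mul_assoc,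
      ← zpow_add, ← mul_assoc, ← pow_add, geom_sum_succ]
    congr 2
    ring

/-- Normal form in `⟨A, B⟩` when `A` and `B` have finite order and `B * A = A * B ^ α`. -/
theorem exists_eq_pow_mul_zpow_of_mem_closure {G : Type*} [Group G] {A B : G} {α : ℤ} {n : ℕ}
    (h : B * A = A * B ^ α) (hn : 0 < n) (hA : A ^ n = 1) {g : G}
    (hg : g ∈ Subgroup.closure {A, B}) : ∃ (k : ℕ) (a : ℤ), g = A ^ k * B ^ a := by
  have hinv : A⁻¹ = A ^ (n - 1) := by
    rw [inv_eq_iff_mul_eq_one, ← pow_succ', Nat.sub_add_cancel hn, hA]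
  induction hg using Subgroup.closure_induction_right with
  | one => exact ⟨0, 0, by simp⟩
  | mul_right g _ y hy ih =>
    obtain ⟨k, a, rfl⟩ := ih
    rcases hy with rfl | rfl
    · refine ⟨k + 1, a * α ^ 1, ?_⟩
      rw [pow_add, mul_assoc, mul_assoc, ← zpow_mul_pow_of_mul_eq h, pow_one]
    · exact ⟨k, a + 1, by rw [zpow_add_one, mul_assoc]⟩
  | mul_inv_cancel g _ y hy ih =>
    obtain ⟨k, a, rfl⟩ := ih
    rcases hy with rfl | rfl
    · refine ⟨k + (n - 1), a * α ^ (n - 1), ?_⟩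
      rw [pow_add, mul_assoc, mul_assoc, ← zpow_mul_pow_of_mul_eq h, hinv]
    · exact ⟨k, a - 1, by rw [zpow_sub_one, mul_assoc]⟩

/-- Integral powers of an invertible diagonal matrix. -/
theorem coe_zpow_of_coe_eq_diagonal {n : Type*} [Fintype n] [DecidableEq n] {K : Type*} [Field K]
    {B : GL n K} {d : n → K} (hd : ∀ i, d i ≠ 0) (hB : (B : Matrix n n K) = Matrix.diagonal d)
    (a : ℤ) : ((B ^ a : GL n K) : Matrix n n K) = Matrix.diagonal fun i => d i ^ a := by
  have key : ∀ m : ℕ, ((B ^ m : GL n K) : Matrix n n K) = Matrix.diagonal fun i => d i ^ m :=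
    fun m => by
      rw [Units.val_pow_eq_pow_val, hB, Matrix.diagonal_pow]
      rfl
  obtain ⟨m, rfl | rfl⟩ := a.eq_nat_or_neg
  · simpa using key m
  · rw [zpow_neg, zpow_natCast]
    refine Units.inv_eq_of_mul_eq_one_right ?_
    rw [key, Matrix.diagonal_mul_diagonal, ← Matrix.diagonal_one]
    congr 1
    funext i
    simp [hd i]

/-- Powers of the companion matrix of `X ^ q - x`. -/
theorem twisted_cycle_pow_apply {R : Type*} [CommRing R] {q : ℕ} {x : R}
    {A : Matrix (Fin q) (Fin q) R}
    (hA : ∀ i j : Fin q, A i j =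
      if (i : ℕ) = 0 ∧ (j : ℕ) = q - 1 then x
      else if (j : ℕ) + 1 = (i : ℕ) then 1 else 0) {n : ℕ} (hn : n ≤ q) (i j : Fin q) :
    (A ^ n) i j = if (j : ℕ) + n = i then 1 else if (j : ℕ) + n = i + q then x else 0 := by
  induction n generalizing i with
  | zero =>
    have := i.isLt
    have := j.isLt
    rw [pow_zero, Matrix.one_apply]
    by_cases h : i = j
    · simp [h]
    · have : (i : ℕ) ≠ j := fun h' => h (Fin.ext h')
      rw [if_neg h, if_neg (by omega), if_neg (by omega)]
  | succ n ih =>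
    have hi := i.isLt
    have hj := j.isLt
    rw [pow_succ', Matrix.mul_apply]
    by_cases h0 : (i : ℕ) = 0
    · rw [Finset.sum_eq_single (⟨q - 1, by omega⟩ : Fin q)]
      · rw [hA, ih (by omega), if_pos ⟨h0, rfl⟩]
        dsimp only
        split_ifs <;> first | omega | simp
      · intro k _ hk
        have : (k : ℕ) ≠ q - 1 := fun h' => hk (Fin.ext h')
        rw [hA, if_neg (by omega), if_neg (by omega), zero_mul]
      · simp
    · rw [Finset.sum_eq_single (⟨i - 1, by omega⟩ : Fin q)]
      · rw [hA, ih (by omega), if_neg (by omega), if_pos (by dsimp only; omega), one_mul]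
        dsimp only
        split_ifs <;> first | omega | rfl
      · intro k _ hk
        have : (k : ℕ) ≠ i - 1 := fun h' => hk (Fin.ext h')
        rw [hA, if_neg (by omega), if_neg (by omega), zero_mul]
      · simp

/-- The companion matrix of `X ^ q - x` satisfies `A ^ q = x`. -/
theorem twisted_cycle_pow_card {R : Type*} [CommRing R] {q : ℕ} {x : R}
    {A : Matrix (Fin q) (Fin q) R}
    (hA : ∀ i j : Fin q, A i j =
      if (i : ℕ) = 0 ∧ (j : ℕ) = q - 1 then x
      else if (j : ℕ) + 1 = (i : ℕ) then 1 else 0) : A ^ q = x • 1 := by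
  ext i j
  rw [twisted_cycle_pow_apply hA le_rfl, Matrix.smul_apply, Matrix.one_apply]
  have := i.isLt
  by_cases h : i = j
  · subst h
    rw [if_neg (by omega), if_pos rfl, if_pos rfl, smul_eq_mul, mul_one]
  · have : (i : ℕ) ≠ j := fun h' => h (Fin.ext h')
    rw [if_neg (by omega), if_neg (by omega), if_neg h, smul_zero]

/-- An eigenvalue `1` gives a nonzero vector fixed by all powers of the matrix. -/
theorem exists_fixed_vector_of_eval_charpoly {n : Type*} [Fintype n] [DecidableEq n] {K : Type*}
    [Field K] {M : Matrix n n K} (h : Polynomial.eval 1 M.charpoly = 0) :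
    ∃ v : n → K, v ≠ 0 ∧ ∀ m : ℕ, (M ^ m).mulVec v = v := by
  rw [Matrix.eval_charpoly, ← Matrix.exists_mulVec_eq_zero_iff] at h
  obtain ⟨v, hv, h⟩ := h
  have h1 : M.mulVec v = v := by
    simpa [Matrix.sub_mulVec, sub_eq_zero, eq_comm] using h
  refine ⟨v, hv, fun m => ?_⟩
  induction m with
  | zero => simp
  | succ m ih => rw [pow_succ, ← Matrix.mulVec_mulVec, h1, ih]

/-- With `A`, `B` as in the setup of Section 3.2, regarded as elements `A'`, `B'`
of `GL(q, ℂ)`: `1` is not an eigenvalue (root of the characteristic polynomial)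
of any matrix in the group `⟨A', B'⟩` except the identity matrix. -/
theorem stmt12 (q : ℕ) (hq : q.Prime) (hqodd : Odd q)
    (l : ℕ) (hl : l.Prime) (hl1 : l % (2 * q) = 1)
    (α : ℤ) (hα : orderOf ((α : ZMod l)) = q)
    (z x : ℂ) (hz : IsPrimitiveRoot z l) (hx : IsPrimitiveRoot x q)
    (A B : Matrix (Fin q) (Fin q) ℂ)
    (hA : ∀ i j : Fin q, A i j =
      if (i : ℕ) = 0 ∧ (j : ℕ) = q - 1 then x
      else if (j : ℕ) + 1 = (i : ℕ) then 1 else 0)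
    (hB : B = Matrix.diagonal (fun i : Fin q => z ^ α ^ (i : ℕ)))
    (A' B' : GL (Fin q) ℂ)
    (hA' : (A' : Matrix (Fin q) (Fin q) ℂ) = A)
    (hB' : (B' : Matrix (Fin q) (Fin q) ℂ) = B) :
    ∀ g ∈ Subgroup.closure {A', B'}, g ≠ 1 →
      Polynomial.eval 1 (Matrix.charpoly (g : Matrix (Fin q) (Fin q) ℂ)) ≠ 0 := by
  have : Fact l.Prime := ⟨hl⟩
  have hq0 := hq.pos
  have hlq : ¬ q ∣ l := fun h => by
    have := (Nat.prime_dvd_prime_iff_eq hq hl).1 h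
    subst this
    rw [Nat.mod_eq_of_lt (by omega)] at hl1
    exact hq.one_lt.ne' hl1
  have hz0 : z ≠ 0 := hz.ne_zero hl.ne_zero
  have hαq : (α : ZMod l) ^ q = 1 := hα ▸ pow_orderOf_eq_one _
  have hα0 : (α : ZMod l) ≠ 0 := fun h => by simp [h, hq.ne_zero] at hαq
  have hzq : z ^ α ^ q = z := by
    have h1 : (l : ℤ) ∣ α ^ q - 1 := by
      rw [← ZMod.intCast_zmod_eq_zero_iff_dvd]
      simp [hαq]
    have h2 := (hz.zpow_eq_one_iff_dvd _).2 h1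
    rwa [zpow_sub₀ hz0, zpow_one, div_eq_one_iff_eq hz0] at h2
  have hBz := coe_zpow_of_coe_eq_diagonal (fun i : Fin q => zpow_ne_zero (α ^ (i : ℕ)) hz0)
    (hB'.trans hB)
  have hBl : ∀ a : ℤ, (l : ℤ) ∣ a → B' ^ a = 1 := by
    intro a ha
    ext1
    rw [hBz, Units.val_one, ← Matrix.diagonal_one]
    congr 1
    funext i
    rw [← zpow_mul, (hz.zpow_eq_one_iff_dvd _).2 (ha.mul_left _)]
  have hcomm : B' * A' = A' * B' ^ α := by
    ext i j
    rw [Units.val_mul, Units.val_mul, hBz, hA', hB', hB, Matrix.diagonal_mul, Matrix.mul_diagonal,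
      ← zpow_mul, ← pow_succ, hA]
    split_ifs with h1 h2
    · rw [h1.1, h1.2, Nat.sub_add_cancel hq0, hzq, pow_zero, zpow_one, mul_comm]
    · rw [h2, mul_comm]
    · simp
  have hAq : ∀ m : ℕ, ((A' ^ (q * m) : GL (Fin q) ℂ) : Matrix (Fin q) (Fin q) ℂ) = x ^ m • 1 := by
    intro m
    rw [Units.val_pow_eq_pow_val, hA', pow_mul, twisted_cycle_pow_card hA, smul_pow, one_pow]
  have hAqq : ∀ m : ℕ, q ∣ m → A' ^ (q * m) = 1 := by
    intro m hm
    ext1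
    rw [hAq, (hx.pow_eq_one_iff_dvd m).2 hm, one_smul, Units.val_one]
  intro g hg hg1 hev
  obtain ⟨k, a, rfl⟩ :=
    exists_eq_pow_mul_zpow_of_mem_closure hcomm (Nat.mul_pos hq0 hq0) (hAqq q dvd_rfl) hg
  obtain ⟨v, hv, hfix⟩ := exists_fixed_vector_of_eval_charpoly hev
  obtain ⟨i, hi⟩ := Function.ne_iff.1 hv
  simp only [← Units.val_pow_eq_pow_val] at hfix
  have hxm : ∀ n m : ℕ, (A' ^ k * B' ^ a) ^ n = A' ^ (q * m) → q ∣ m := by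
    intro n m h
    have h1 := congrFun (hfix n) i
    rw [h, hAq, Matrix.smul_mulVec, Matrix.one_mulVec, Pi.smul_apply, smul_eq_mul] at h1
    exact (hx.pow_eq_one_iff_dvd m).1 (mul_right_cancel₀ hi (h1.trans (one_mul _).symm))
  have hqk : q ∣ k := by
    by_contra hk
    refine hk (hxm q k ?_)
    rw [pow_mul_zpow_pow_of_mul_eq hcomm, hBl, mul_one, mul_comm]
    refine Dvd.dvd.mul_left ?_ _
    rw [← ZMod.intCast_zmod_eq_zero_iff_dvd]
    have h1 : (α : ZMod l) ^ k - 1 ≠ 0 := fun h =>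
      hk (hα ▸ orderOf_dvd_of_pow_eq_one (sub_eq_zero.1 h))
    have h2 := geom_sum_mul ((α : ZMod l) ^ k) q
    rw [← pow_mul, mul_comm k, pow_mul, hαq, one_pow, sub_self] at h2
    push_cast
    exact (mul_eq_zero.1 h2).resolve_right h1
  obtain ⟨m, rfl⟩ := hqk
  have hqm : q ∣ m := by
    refine (hq.dvd_mul.1 (hxm l (m * l) ?_)).resolve_right hlq
    have h1 : Commute (A' ^ (q * m)) (B' ^ a) := by
      refine Units.ext ?_
      rw [Units.val_mul, Units.val_mul, hAq]
      simp
    rw [h1.mul_pow, ← pow_mul, ← zpow_natCast (B' ^ a), ← zpow_mul, hBl _ (dvd_mul_left _ _), mul_one,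
      mul_assoc]
  rw [hAqq m hqm, one_mul] at hg1 hfix
  refine hg1 (hBl a ?_)
  have h1 := congrFun (hfix 1) i
  rw [pow_one, hBz, Matrix.mulVec_diagonal] at h1
  have h2 := mul_right_cancel₀ hi (h1.trans (one_mul _).symm)
  rw [← zpow_mul, hz.zpow_eq_one_iff_dvd] at h2
  rw [← ZMod.intCast_zmod_eq_zero_iff_dvd] at h2 ⊢
  push_cast at h2
  exact (mul_eq_zero.1 h2).resolve_left (pow_ne_zero _ hα0)
end

section
/- Let q be an odd prime, l a prime with l ≡ 1 (mod 2q), α an integer whose residue class has multiplicative order q in (ℤ/lℤ)^×, z a primitive l-th root of unity in ℂ, and x a primitive q-th root of unity in ℂ. Let A be the q × q complex matrix whose only nonzero entries are A(0, q−1) = x and A(i, i−1) = 1 for i = 1, …, q−1, and let B be the diagonal matrix with diagonal entries z^{α⁰}, z^{α¹}, …, z^{α^{q−1}}. Let r and s be nonnegative integers and write r = uq + v with 0 ≤ v < q. If v ≠ 0, then the characteristic polynomial of A^r B^s equals X^q − x^v; in particular 1 is not an eigenvalue of A^r B^s. -/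
open Polynomial in
/-- A monic complex polynomial of positive degree `q` whose values are invariant under scaling the
argument by a primitive `q`-th root of unity is `X ^ q` plus its constant coefficient. -/
theorem Polynomial.eq_X_pow_add_C_of_eval_mul_primitiveRoot {q : ℕ} (hq : 0 < q) {p : ℂ[X]}
    (hp : p.Monic) (hdeg : p.natDegree = q) {w : ℂ} (hw : IsPrimitiveRoot w q)
    (h : ∀ t, p.eval (w * t) = p.eval t) : p = X ^ q + C (p.coeff 0) := by
  have hcomp : p.comp (C w * X) = p := Polynomial.funext fun t => by simp [h]
  ext k
  rcases lt_trichotomy k q with hk | rfl | hk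
  · rcases Nat.eq_zero_or_pos k with rfl | hk0
    · simp [coeff_X_pow, hq.ne]
    · have h1 : p.coeff k * w ^ k = p.coeff k := by
        rw [← comp_C_mul_X_coeff, hcomp]
      have h2 : w ^ k ≠ 1 := hw.pow_ne_one_of_pos_of_lt hk0.ne' hk
      have h3 : p.coeff k = 0 := by
        by_contra h0
        exact h2 (mul_left_cancel₀ h0 (by rw [h1, mul_one]))
      simp [coeff_X_pow, coeff_C, hk.ne, hk0.ne', h3]
  · have : p.coeff k = 1 := by rw [← hdeg]; exact hp
    simp [coeff_X_pow, coeff_C, hq.ne', this]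
  · rw [coeff_eq_zero_of_natDegree_lt (hdeg ▸ hk)]
    simp [coeff_X_pow, coeff_C, hk.ne', (hq.trans hk).ne']

/-- If `D * M = c • (M * D)` with `D` invertible and `c ^ card n = 1`, then the characteristic
polynomial of `M` is invariant under scaling the argument by `c`. -/
theorem Matrix.eval_charpoly_mul_of_mul_eq_smul_mul {n K : Type*} [Fintype n] [DecidableEq n]
    [Field K] {D M : Matrix n n K} {c : K} (hD : D.det ≠ 0) (hc : c ^ Fintype.card n = 1)
    (h : D * M = c • (M * D)) (t : K) : M.charpoly.eval (c * t) = M.charpoly.eval t := by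
  rw [Matrix.eval_charpoly, Matrix.eval_charpoly]
  have key : D * (Matrix.scalar n (c * t) - M) = c • ((Matrix.scalar n t - M) * D) := by
    rw [mul_sub, sub_mul, h, smul_sub]
    congr 1
    ext i j
    simp [Matrix.scalar_apply]
    ring
  have hdet := congrArg Matrix.det key
  rw [Matrix.det_mul, Matrix.det_smul, hc, one_mul, Matrix.det_mul, mul_comm] at hdet
  exact mul_right_cancel₀ hD hdet

/-- The twisted cyclic shift of odd size with corner entry `x` has determinant `x`. -/
theorem Matrix.det_twisted_shift {q : ℕ} (hodd : Odd q) {R : Type*} [CommRing R] (x : R)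
    (A : Matrix (Fin q) (Fin q) R)
    (hA : ∀ i j : Fin q, A i j =
      if (i : ℕ) = 0 ∧ (j : ℕ) = q - 1 then x
      else if (j : ℕ) + 1 = (i : ℕ) then 1 else 0) : A.det = x := by
  obtain ⟨n, rfl⟩ : ∃ n, q = n + 1 := ⟨q - 1, by have := hodd.pos; omega⟩
  have hn : Even n := by
    rcases Nat.even_or_odd n with h | h
    · exact h
    · exact absurd hodd (by simpa using h.add_one)
  have hdiag : A.submatrix (finRotate (n + 1)) id =
      Matrix.diagonal (fun i : Fin (n + 1) => if i = Fin.last n then x else 1) := by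
    ext i j
    rw [Matrix.submatrix_apply, hA, Matrix.diagonal_apply, coe_finRotate]
    simp only [Fin.ext_iff, Fin.val_last, id]
    grind
  have hdet := Matrix.det_permute (finRotate (n + 1)) A
  rw [hdiag, Matrix.det_diagonal, sign_finRotate, Nat.add_sub_cancel, hn.neg_one_pow] at hdet
  simpa using hdet.symm

/-- The diagonal matrix of powers of `x` commutes with the twisted cyclic shift up to the
factor `x`. -/
theorem Matrix.diagonal_pow_mul_twisted_shift {q : ℕ} {R : Type*} [CommRing R] {x : R}
    (hx : x ^ q = 1) (A : Matrix (Fin q) (Fin q) R)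
    (hA : ∀ i j : Fin q, A i j =
      if (i : ℕ) = 0 ∧ (j : ℕ) = q - 1 then x
      else if (j : ℕ) + 1 = (i : ℕ) then 1 else 0) :
    Matrix.diagonal (fun i : Fin q => x ^ (i : ℕ)) * A =
      x • (A * Matrix.diagonal (fun i : Fin q => x ^ (i : ℕ))) := by
  ext i j
  rw [Matrix.diagonal_mul, Matrix.smul_apply, Matrix.mul_diagonal, hA, smul_eq_mul]
  split_ifs with h1 h2
  · rw [h1.1, h1.2, pow_zero, one_mul, mul_left_comm, ← pow_succ',
      Nat.sub_add_cancel (Nat.one_le_iff_ne_zero.2 (by have := i.2; omega)), hx, mul_one]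
  · rw [← h2, pow_succ']; ring
  · simp

/-- An integer of multiplicative order `q > 1` modulo a prime `l` satisfies
`l ∣ 1 + α + ⋯ + α ^ (q - 1)`. -/
theorem dvd_geom_sum_of_orderOf_eq {q l : ℕ} (hq : 1 < q) (hl : l.Prime) {α : ℤ}
    (hα : orderOf (α : ZMod l) = q) : (l : ℤ) ∣ ∑ i ∈ Finset.range q, α ^ i := by
  have := Fact.mk hl
  rw [← ZMod.intCast_zmod_eq_zero_iff_dvd]
  push_cast
  have hne : (α : ZMod l) - 1 ≠ 0 := fun h => by
    rw [sub_eq_zero.1 h, orderOf_one] at hα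
    omega
  have hgeom := geom_sum_mul (α : ZMod l) q
  rw [← hα, pow_orderOf_eq_one, sub_self, hα] at hgeom
  exact (mul_eq_zero.1 hgeom).resolve_right hne

theorem prod_zpow_eq_zpow_sum {ι K : Type*} [Field K] {z : K} (hz : z ≠ 0) (s : Finset ι)
    (f : ι → ℤ) : ∏ i ∈ s, z ^ f i = z ^ ∑ i ∈ s, f i := by
  classical
  induction s using Finset.induction_on with
  | empty => simp
  | insert a s ha ih => rw [Finset.prod_insert ha, Finset.sum_insert ha, zpow_add₀ hz, ih]

/-- With `A`, `B` as in the setup of Section 3.2: if `r = u * q + v` with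
`0 < v < q`, then the characteristic polynomial of `A ^ r * B ^ s` is
`X ^ q - x ^ v`; in particular `1` is not an eigenvalue of `A ^ r * B ^ s`. -/
theorem stmt13 (q : ℕ) (hq : q.Prime) (hqodd : Odd q)
    (l : ℕ) (hl : l.Prime) (hl1 : l % (2 * q) = 1)
    (α : ℤ) (hα : orderOf ((α : ZMod l)) = q)
    (z x : ℂ) (hz : IsPrimitiveRoot z l) (hx : IsPrimitiveRoot x q)
    (A B : Matrix (Fin q) (Fin q) ℂ)
    (hA : ∀ i j : Fin q, A i j =
      if (i : ℕ) = 0 ∧ (j : ℕ) = q - 1 then x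
      else if (j : ℕ) + 1 = (i : ℕ) then 1 else 0)
    (hB : B = Matrix.diagonal (fun i : Fin q => z ^ α ^ (i : ℕ)))
    (r s u v : ℕ) (hr : r = u * q + v) (hv : v < q) (hv0 : v ≠ 0) :
    Matrix.charpoly (A ^ r * B ^ s) = Polynomial.X ^ q - Polynomial.C (x ^ v) ∧
    Polynomial.eval 1 (Matrix.charpoly (A ^ r * B ^ s)) ≠ 0 := by
  have hxq : x ^ q = 1 := hx.pow_eq_one
  have hxr : x ^ r = x ^ v := by rw [hr, pow_add, mul_comm u q, pow_mul, hxq, one_pow, one_mul]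
  have hw : IsPrimitiveRoot (x ^ r) q := by
    rw [hxr]
    exact hx.pow_of_coprime v
      ((hq.coprime_iff_not_dvd.2 (Nat.not_dvd_of_pos_of_lt (Nat.pos_of_ne_zero hv0) hv)).symm)
  have hdetB : B.det = 1 := by
    rw [hB, Matrix.det_diagonal, prod_zpow_eq_zpow_sum (hz.ne_zero hl.ne_zero),
      Fin.sum_univ_eq_sum_range (fun i => α ^ i), hz.zpow_eq_one_iff_dvd]
    exact dvd_geom_sum_of_orderOf_eq hq.one_lt hl hα
  have hdet : (A ^ r * B ^ s).det = x ^ v := by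
    rw [Matrix.det_mul, Matrix.det_pow, Matrix.det_pow, hdetB,
      Matrix.det_twisted_shift hqodd x A hA, one_pow, mul_one, hxr]
  set D : Matrix (Fin q) (Fin q) ℂ := Matrix.diagonal (fun i => x ^ (i : ℕ)) with hD
  have hDdet : D.det ≠ 0 := by
    rw [hD, Matrix.det_diagonal]
    exact Finset.prod_ne_zero_iff.2 fun i _ => pow_ne_zero _ (hx.ne_zero hq.ne_zero)
  have hDA (k : ℕ) : D * A ^ k = x ^ k • (A ^ k * D) := by
    induction k with
    | zero => simp
    | succ k ih =>
      rw [pow_succ, ← mul_assoc, ih, smul_mul_assoc, mul_assoc,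
        Matrix.diagonal_pow_mul_twisted_shift hxq A hA, mul_smul_comm, smul_smul, mul_assoc,
        pow_succ]
  have hDB : Commute D (B ^ s) := by
    refine Commute.pow_right ?_ s
    rw [hB]
    exact Matrix.commute_diagonal _ _
  have hDM : D * (A ^ r * B ^ s) = x ^ r • (A ^ r * B ^ s * D) := by
    rw [← mul_assoc, hDA, smul_mul_assoc, mul_assoc, hDB.eq, ← mul_assoc]
  have hchar : Matrix.charpoly (A ^ r * B ^ s) =
      Polynomial.X ^ q - Polynomial.C (x ^ v) := by
    have h := Polynomial.eq_X_pow_add_C_of_eval_mul_primitiveRoot hq.pos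
      (Matrix.charpoly_monic (A ^ r * B ^ s))
      (by rw [Matrix.charpoly_natDegree_eq_dim, Fintype.card_fin]) hw
      (Matrix.eval_charpoly_mul_of_mul_eq_smul_mul hDdet
        (by rw [Fintype.card_fin]; exact hw.pow_eq_one) hDM)
    have h0 := Matrix.det_eq_sign_charpoly_coeff (A ^ r * B ^ s)
    rw [hdet, Fintype.card_fin, hqodd.neg_one_pow, neg_one_mul] at h0
    rw [h, h0, Polynomial.C_neg, sub_neg_eq_add]
  refine ⟨hchar, ?_⟩
  rw [hchar]
  simpa [sub_eq_zero] using (hx.pow_ne_one_of_pos_of_lt hv0 hv).symm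
end

section
/- Let n be an odd composite number (n odd, n > 1, and n not prime). Then there exists a finite non-abelian subgroup G of SL(n, ℂ) such that 1 is not an eigenvalue of any matrix in G except the identity matrix. -/
section Metacyclic

variable {Γ : Type*} [Group Γ] {a b : Γ}

theorem pow_mul_pow_of_mul_eq_sq_mul (h : b * a = a ^ 2 * b) (i j : ℕ) :
    b ^ j * a ^ i = a ^ (2 ^ j * i) * b ^ j := by
  have h₁ : SemiconjBy b a (a ^ 2) := h
  have key : ∀ j : ℕ, SemiconjBy (b ^ j) a (a ^ 2 ^ j) := by
    intro j
    induction j with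
    | zero => simp [SemiconjBy]
    | succ j ih =>
      rw [pow_succ' b, pow_succ' 2, pow_mul]
      exact (h₁.pow_right (2 ^ j)).mul_left ih
  rw [pow_mul]
  exact (key j).pow_right i

theorem exists_mul_pow_eq (h : b * a = a ^ 2 * b) (i j n : ℕ) :
    ∃ s, (a ^ i * b ^ j) ^ n = a ^ s * b ^ (j * n) := by
  induction n with
  | zero => exact ⟨0, by simp⟩
  | succ n ih =>
    obtain ⟨s, hs⟩ := ih
    refine ⟨s + 2 ^ (j * n) * i, ?_⟩
    rw [pow_succ, hs, mul_assoc, ← mul_assoc (b ^ (j * n)), pow_mul_pow_of_mul_eq_sq_mul h,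
      mul_assoc, ← pow_add, ← mul_assoc, ← pow_add, mul_add_one]

theorem exists_finite_subgroup_of_mul_eq_sq_mul (h : b * a = a ^ 2 * b)
    (ha : IsOfFinOrder a) (hb : IsOfFinOrder b) :
    ∃ G : Subgroup Γ, Finite G ∧ a ∈ G ∧ b ∈ G ∧
      ∀ g ∈ G, ∃ i j : ℕ, g = a ^ i * b ^ j := by
  have hfin : (Set.image2 (· * ·) (Submonoid.powers a : Set Γ) (Submonoid.powers b)).Finite :=
    (finite_powers.2 ha).image2 _ (finite_powers.2 hb)
  let M : Submonoid Γ :=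
    { carrier := Set.image2 (· * ·) (Submonoid.powers a : Set Γ) (Submonoid.powers b)
      one_mem' := ⟨1, one_mem _, 1, one_mem _, mul_one 1⟩
      mul_mem' := by
        rintro _ _ ⟨_, ⟨i, rfl⟩, _, ⟨j, rfl⟩, rfl⟩ ⟨_, ⟨k, rfl⟩, _, ⟨l, rfl⟩, rfl⟩
        refine ⟨_, ⟨i + 2 ^ j * k, rfl⟩, _, ⟨j + l, rfl⟩, ?_⟩
        simp only
        rw [mul_assoc (a ^ i), ← mul_assoc (b ^ j), pow_mul_pow_of_mul_eq_sq_mul h,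
          pow_add, pow_add]
        simp only [mul_assoc] }
  have : Finite M := hfin
  refine ⟨{ M with
    inv_mem' := fun {g} hg => ?_ }, this, ?_, ?_, ?_⟩
  · have hg' : IsOfFinOrder g := by
      rw [← finite_powers]
      exact hfin.subset (Submonoid.powers_le.2 (show g ∈ M from hg))
    exact (Submonoid.powers_le.2 (show g ∈ M from hg)) (hg'.mem_powers_iff_mem_zpowers.2
      (inv_mem (Subgroup.mem_zpowers g)))
  · exact ⟨a, Submonoid.mem_powers a, 1, one_mem _, mul_one a⟩
  · exact ⟨1, one_mem _, b, Submonoid.mem_powers b, one_mul b⟩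
  · rintro _ ⟨_, ⟨i, rfl⟩, _, ⟨j, rfl⟩, rfl⟩
    exact ⟨i, j, rfl⟩

end Metacyclic

open Matrix in
theorem exists_fixedPointFree_subgroup {ι : Type*} [Fintype ι] [DecidableEq ι] [Nonempty ι]
    {p m : ℕ} (hp : Odd p) (hm : 1 < m) (hmp : m.Coprime p)
    (σ : Equiv.Perm ι) (hσ : σ ^ p = 1) (χ η : ι → ℂ)
    (hχ : ∀ i, IsPrimitiveRoot (χ i) m) (hη : ∀ i, IsPrimitiveRoot (η i) (p * p))
    (hχσ : ∀ i, χ (σ i) = χ i ^ 2) (hησ : ∀ i, η (σ i) = η i) (hη_prod : ∏ i, η i = 1) :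
    ∃ G : Subgroup (Matrix.SpecialLinearGroup ι ℂ),
      Finite G ∧
      ¬ (∀ a ∈ G, ∀ b ∈ G, a * b = b * a) ∧
      ∀ g ∈ G, g ≠ 1 →
        Polynomial.eval 1 (Matrix.charpoly (g : Matrix ι ι ℂ)) ≠ 0 := by
  have hχ0 : ∀ i, χ i ≠ 0 := fun i => (hχ i).ne_zero (by omega)
  have hχ_prod : ∏ i, χ i = 1 := by
    have h : ∏ i, χ i = (∏ i, χ i) ^ 2 := by
      rw [← Finset.prod_pow, ← Equiv.prod_comp σ χ]
      exact Finset.prod_congr rfl fun i _ => hχσ i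
    have h0 : ∏ i, χ i ≠ 0 := Finset.prod_ne_zero_iff.2 fun i _ => hχ0 i
    exact mul_left_cancel₀ h0 (by rw [mul_one, ← sq]; exact h.symm)
  have hsign : Equiv.Perm.sign σ = 1 := by
    have h : Equiv.Perm.sign σ ^ p = 1 := by rw [← map_pow, hσ, map_one]
    rcases Int.units_eq_one_or (Equiv.Perm.sign σ) with h' | h'
    · exact h'
    · rw [h', hp.neg_one_pow] at h
      exact absurd h (by decide)
  let a : SpecialLinearGroup ι ℂ := ⟨diagonal χ, by rw [det_diagonal, hχ_prod]⟩
  let b : SpecialLinearGroup ι ℂ := ⟨diagonal η * σ.permMatrix ℂ, by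
    rw [det_mul, det_diagonal, hη_prod, det_permutation, hsign]; simp⟩
  have ext_mulVec : ∀ g h : SpecialLinearGroup ι ℂ,
      (∀ v, (g : Matrix ι ι ℂ) *ᵥ v = (h : Matrix ι ι ℂ) *ᵥ v) → g = h :=
    fun g h H => Subtype.ext (Matrix.ext_of_mulVec_single fun i => H _)
  have hmul : ∀ (g h : SpecialLinearGroup ι ℂ) (v : ι → ℂ),
      ((g * h : SpecialLinearGroup ι ℂ) : Matrix ι ι ℂ) *ᵥ v
        = (g : Matrix ι ι ℂ) *ᵥ ((h : Matrix ι ι ℂ) *ᵥ v) :=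
    fun g h v => (mulVec_mulVec v g.1 h.1).symm
  have ha : ∀ n v i, (((a ^ n : SpecialLinearGroup ι ℂ) : Matrix ι ι ℂ) *ᵥ v) i
      = χ i ^ n * v i := by
    intro n v i
    change ((diagonal χ ^ n) *ᵥ v) i = _
    rw [diagonal_pow, mulVec_diagonal, Pi.pow_apply]
  have hb₁ : ∀ v i, ((b : Matrix ι ι ℂ) *ᵥ v) i = η i * v (σ i) := by
    intro v i
    change ((diagonal η * σ.permMatrix ℂ) *ᵥ v) i = _
    rw [← mulVec_mulVec, mulVec_diagonal, permMatrix_mulVec, Function.comp_apply]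
  have hb : ∀ n v i, (((b ^ n : SpecialLinearGroup ι ℂ) : Matrix ι ι ℂ) *ᵥ v) i
      = η i ^ n * v ((σ ^ n) i) := by
    intro n
    induction n with
    | zero => simp
    | succ n ih =>
      intro v i
      rw [pow_succ', hmul, hb₁, ih, hησ, pow_succ' (η i),
        pow_succ σ, Equiv.Perm.mul_apply, mul_assoc]
  have hbp : ∀ n v i, (((b ^ (p * n) : SpecialLinearGroup ι ℂ) : Matrix ι ι ℂ) *ᵥ v) i
      = η i ^ (p * n) * v i := by
    intro n v i
    rw [hb, pow_mul σ, hσ, one_pow, Equiv.Perm.one_apply]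
  have hrel : b * a = a ^ 2 * b := by
    refine ext_mulVec _ _ fun v => funext fun i => ?_
    have h₁ := ha 1 v (σ i)
    rw [pow_one, pow_one] at h₁
    rw [hmul, hmul, hb₁, ha, hb₁, h₁, hχσ]
    ring
  have ham : a ^ m = 1 := ext_mulVec _ _ fun v => funext fun i => by
    rw [ha, (hχ i).pow_eq_one]; simp
  have hbN : b ^ (p * p) = 1 := ext_mulVec _ _ fun v => funext fun i => by
    rw [hbp, (hη i).pow_eq_one]; simp
  have hfix : ∀ (i j : ℕ) (v : ι → ℂ), v ≠ 0 →
      ((a ^ i * b ^ (p * j) : SpecialLinearGroup ι ℂ) : Matrix ι ι ℂ) *ᵥ v = v →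
      p ∣ j ∧ m ∣ i := by
    intro i j v hv h
    obtain ⟨x, hx⟩ := Function.ne_iff.1 hv
    have h₁ := congrFun h x
    rw [hmul, ha, hbp, ← mul_assoc] at h₁
    have h₂ : χ x ^ i * η x ^ (p * j) = 1 := mul_right_cancel₀ hx (by rw [h₁, one_mul])
    have hm₁ : (χ x ^ i) ^ m = 1 := by rw [pow_right_comm, (hχ x).pow_eq_one, one_pow]
    have hp₁ : (η x ^ (p * j)) ^ p = 1 := by
      rw [← pow_mul, mul_right_comm, pow_mul, (hη x).pow_eq_one, one_pow]
    have hp₂ : (χ x ^ i) ^ p = 1 := by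
      have := congrArg (· ^ p) h₂
      simpa [mul_pow, hp₁] using this
    have h₃ : χ x ^ i = 1 := by
      have := pow_gcd_eq_one.2 ⟨hm₁, hp₂⟩
      rwa [Nat.Coprime.gcd_eq_one hmp, pow_one] at this
    rw [h₃, one_mul] at h₂
    exact ⟨Nat.dvd_of_mul_dvd_mul_left hp.pos ((hη x).dvd_of_pow_eq_one _ h₂),
      (hχ x).dvd_of_pow_eq_one _ h₃⟩
  obtain ⟨G, hG, haG, hbG, hGab⟩ := exists_finite_subgroup_of_mul_eq_sq_mul hrel
    (isOfFinOrder_iff_pow_eq_one.2 ⟨m, by omega, ham⟩)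
    (isOfFinOrder_iff_pow_eq_one.2 ⟨p * p, Nat.mul_pos hp.pos hp.pos, hbN⟩)
  refine ⟨G, hG, fun hcomm => ?_, fun g hg hg1 heval => hg1 ?_⟩
  · have h := (hcomm a haG b hbG).trans hrel
    have ha1 : a = 1 := by
      rw [sq] at h
      simpa using mul_right_cancel h
    obtain ⟨x⟩ := ‹Nonempty ι›
    have h₁ := ha 1 1 x
    rw [pow_one, ha1] at h₁
    have h₂ : χ x = 1 := by simpa using h₁.symm
    have := (hχ x).dvd_of_pow_eq_one 1 (by simpa using h₂)
    have := Nat.le_of_dvd one_pos this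
    omega
  · rw [eval_charpoly, map_one] at heval
    obtain ⟨v, hv, hgv⟩ := exists_mulVec_eq_zero_iff.2 heval
    rw [sub_mulVec, one_mulVec, sub_eq_zero] at hgv
    replace hgv := hgv.symm
    obtain ⟨i, j, rfl⟩ := hGab g hg
    obtain ⟨s, hs⟩ := exists_mul_pow_eq hrel i j p
    have hpow : ∀ (h : SpecialLinearGroup ι ℂ) (n : ℕ), (h : Matrix ι ι ℂ) *ᵥ v = v →
        ((h ^ n : SpecialLinearGroup ι ℂ) : Matrix ι ι ℂ) *ᵥ v = v := by
      intro h n hh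
      induction n with
      | zero => simp
      | succ n ih => rw [pow_succ, hmul, hh, ih]
    have h₁ := hpow _ p hgv
    rw [hs, mul_comm j] at h₁
    obtain ⟨j, rfl⟩ := (hfix _ _ v hv h₁).1
    obtain ⟨⟨c, rfl⟩, ⟨d, rfl⟩⟩ := hfix _ _ v hv hgv
    rw [← mul_assoc, pow_mul b, hbN, pow_mul a, ham, one_pow, one_pow, one_mul]

theorem ZMod.exists_fin_sum_eq {p : ℕ} [Fact p.Prime] (hp : 2 < p) (k : ℕ) {c : ZMod p}
    (hc : c ≠ 0) : ∃ e : Fin (k + 1) → ZMod p, (∀ l, e l ≠ 0) ∧ ∑ l, e l = c := by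
  induction k generalizing c with
  | zero => exact ⟨fun _ => c, fun _ => hc, by simp⟩
  | succ k ih =>
    obtain ⟨d, hd⟩ : ∃ d, d ∉ ({0, c} : Finset (ZMod p)) := by
      by_contra! h
      have h₁ := Finset.card_le_card (fun d _ => h d : Finset.univ ⊆ ({0, c} : Finset (ZMod p)))
      rw [Finset.card_univ, ZMod.card] at h₁
      exact absurd (h₁.trans Finset.card_le_two) (by omega)
    simp only [Finset.mem_insert, Finset.mem_singleton, not_or] at hd
    obtain ⟨e, he, hsum⟩ := ih (c := c - d) (sub_ne_zero.2 (Ne.symm hd.2))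
    refine ⟨Fin.cons d e, Fin.cases hd.1 he, ?_⟩
    rw [Fin.sum_univ_succ]
    simp [hsum]

/-- If `n` is an odd composite number (`n` odd, `n > 1`, `n` not prime), then
there exists a finite non-abelian subgroup `G` of `SL(n, ℂ)` such that `1` is
not an eigenvalue (root of the characteristic polynomial) of any matrix in `G`
except the identity. -/
theorem stmt14 (n : ℕ) (hodd : Odd n) (hn : 1 < n) (hnp : ¬ n.Prime) :
    ∃ G : Subgroup (Matrix.SpecialLinearGroup (Fin n) ℂ),
      Finite G ∧
      ¬ (∀ a ∈ G, ∀ b ∈ G, a * b = b * a) ∧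
      ∀ g ∈ G, g ≠ 1 →
        Polynomial.eval 1 (Matrix.charpoly (g : Matrix (Fin n) (Fin n) ℂ)) ≠ 0 := by
  obtain ⟨p, hp, k, rfl⟩ := Nat.exists_prime_and_dvd hn.ne'
  have : Fact p.Prime := ⟨hp⟩
  have hp_odd : Odd p := Nat.Odd.of_mul_left hodd
  have hp2 : 2 < p := by
    have := hp.two_le
    obtain ⟨r, hr⟩ := hp_odd
    omega
  obtain ⟨k, rfl⟩ : ∃ k', k = k' + 2 := by
    match k with
    | 0 => simp at hn
    | 1 => simp [hp] at hnp
    | k + 2 => exact ⟨k, rfl⟩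
  obtain ⟨e, he, he_sum⟩ : ∃ e : Fin (k + 2) → ZMod p, (∀ l, e l ≠ 0) ∧ ∑ l, e l = 0 := by
    obtain ⟨e, he, hsum⟩ := ZMod.exists_fin_sum_eq hp2 k (neg_ne_zero.2 (one_ne_zero (α := ZMod p)))
    refine ⟨Fin.cons 1 e, Fin.cases one_ne_zero he, ?_⟩
    rw [Fin.sum_univ_succ]
    simp [hsum]
  let m := 2 ^ p - 1
  have hm_succ : m + 1 = 2 ^ p := Nat.sub_add_cancel Nat.one_le_two_pow
  have hm : 1 < m := by
    have : 2 ^ 2 ≤ 2 ^ p := Nat.pow_le_pow_right two_pos hp2.le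
    omega
  have hm_odd : Odd m := by
    have : Even (m + 1) := hm_succ ▸ (even_two.pow_of_ne_zero hp.ne_zero)
    rwa [Nat.even_add_one, Nat.not_even_iff_odd] at this
  have hmp : m.Coprime p := by
    refine Nat.Coprime.symm ((Nat.Prime.coprime_iff_not_dvd hp).2 fun h => ?_)
    rw [← ZMod.natCast_eq_zero_iff] at h
    have h₁ := congrArg (Nat.cast (R := ZMod p)) hm_succ
    push_cast at h₁
    rw [h, ZMod.pow_card, zero_add] at h₁
    have h₂ : (1 : ZMod p) = 0 := by linear_combination -h₁
    exact one_ne_zero h₂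
  obtain ⟨ζ, hζ⟩ : ∃ ζ : ℂ, IsPrimitiveRoot ζ m :=
    ⟨_, Complex.isPrimitiveRoot_exp m (by omega)⟩
  obtain ⟨η, hη⟩ : ∃ η : ℂ, IsPrimitiveRoot η (p * p) :=
    ⟨_, Complex.isPrimitiveRoot_exp (p * p) (mul_ne_zero hp.ne_zero hp.ne_zero)⟩
  have hζp : ζ ^ 2 ^ p = ζ := by rw [← hm_succ, pow_succ, hζ.pow_eq_one, one_mul]
  let E : Fin (p * (k + 2)) ≃ ZMod p × Fin (k + 2) :=
    Fintype.equivOfCardEq (by simp [ZMod.card])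
  have : Nonempty (Fin (p * (k + 2))) := ⟨⟨0, by omega⟩⟩
  let τ : Equiv.Perm (ZMod p × Fin (k + 2)) := (Equiv.addRight 1).prodCongr (Equiv.refl _)
  have hτ : ∀ (n : ℕ) x, (τ ^ n) x = (x.1 + n, x.2) := by
    intro n
    induction n with
    | zero => simp
    | succ n ih =>
      intro x
      rw [pow_succ', Equiv.Perm.mul_apply, ih]
      simp [τ, add_assoc]
  refine exists_fixedPointFree_subgroup hp_odd hm hmp (E.symm.permCongr τ) ?_
    (fun i => ζ ^ 2 ^ (E i).1.val) (fun i => η ^ (e (E i).2).val) ?_ ?_ ?_ ?_ ?_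
  · have h : τ ^ p = 1 := Equiv.ext fun x => by simp [hτ]
    rw [← Equiv.permCongrHom_coe, ← map_pow, h, map_one]
  · exact fun i => hζ.pow_of_coprime _ (Nat.Coprime.pow_left _ (Nat.coprime_two_left.2 hm_odd))
  · refine fun i => hη.pow_of_coprime _ (Nat.Coprime.mul_right ?_ ?_) <;>
    exact Nat.Coprime.symm (Nat.coprime_of_lt_prime
      (by simpa [ZMod.val_eq_zero] using he _) (ZMod.val_lt _) hp)
  · intro i
    have h : (E (E.symm.permCongr τ i)).1 = (E i).1 + 1 := by simp [τ]
    simp only [h]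
    rw [← pow_mul, ← pow_succ]
    rcases Nat.lt_or_ge ((E i).1.val + 1) p with hlt | hge
    · rw [ZMod.val_add_of_lt] <;> simp [ZMod.val_one, hlt]
    · have hval : (E i).1.val + 1 = p := le_antisymm (ZMod.val_lt _) hge
      have h0 : (E i).1 + 1 = 0 := by
        rw [← ZMod.natCast_zmod_val (E i).1, ← Nat.cast_succ, Nat.succ_eq_add_one, hval,
          ZMod.natCast_self]
      rw [h0, hval, hζp]
      simp
  · intro i
    simp [τ]
  · rw [Equiv.prod_comp E (fun x => η ^ (e x.2).val), Finset.prod_pow_eq_pow_sum,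
      Fintype.sum_prod_type]
    simp only [Finset.sum_const, Finset.card_univ, ZMod.card, smul_eq_mul]
    obtain ⟨c, hc⟩ : p ∣ ∑ l, (e l).val := by
      rw [← ZMod.natCast_eq_zero_iff]
      simpa using he_sum
    rw [hc, ← mul_assoc, pow_mul, hη.pow_eq_one, one_pow]
end

section
/- Let n be an integer with n > 1 such that n is not an odd prime number. Then there exists a finite non-cyclic subgroup G of SL(n, ℂ) such that 1 is not an eigenvalue of any matrix in G except the identity matrix. -/
theorem pow_mul_pow_of_mul_eq_pow_mul {G : Type*} [Monoid G] {x y : G} {r : ℕ}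
    (h : y * x = x ^ r * y) (i j : ℕ) : y ^ j * x ^ i = x ^ (r ^ j * i) * y ^ j := by
  induction j with
  | zero => simp
  | succ j ih =>
    have key (a : ℕ) : y * x ^ a = x ^ (r * a) * y := by
      rw [pow_mul]
      exact SemiconjBy.pow_right (show SemiconjBy y x (x ^ r) from h) a
    rw [pow_succ', mul_assoc, ih, ← mul_assoc, key, mul_assoc, ← mul_assoc r, ← pow_succ']

theorem pow_mul_pow_pow_of_mul_eq_pow_mul {G : Type*} [Monoid G] {x y : G} {r : ℕ}
    (h : y * x = x ^ r * y) (i j k : ℕ) :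
    (x ^ i * y ^ j) ^ k = x ^ (i * ∑ l ∈ Finset.range k, (r ^ j) ^ l) * y ^ (j * k) := by
  induction k with
  | zero => simp
  | succ k ih =>
    rw [pow_succ, ih, mul_assoc, ← mul_assoc (y ^ (j * k)),
      pow_mul_pow_of_mul_eq_pow_mul h, mul_assoc, ← mul_assoc, ← pow_add, ← pow_add,
      Finset.sum_range_succ]
    congr 2
    ring

theorem exists_eq_pow_mul_pow_of_mem_closure {G : Type*} [Group G] {x y : G} {r a b : ℕ}
    (h : y * x = x ^ r * y) (ha : 0 < a) (hb : 0 < b) (hx : x ^ a = 1) (hy : y ^ b = 1)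
    {g : G} (hg : g ∈ Subgroup.closure {x, y}) : ∃ i j : ℕ, g = x ^ i * y ^ j := by
  induction hg using Subgroup.closure_induction with
  | mem g hg =>
    rcases hg with rfl | rfl
    · exact ⟨1, 0, by simp⟩
    · exact ⟨0, 1, by simp⟩
  | one => exact ⟨0, 0, by simp⟩
  | mul g k _ _ hg hk =>
    obtain ⟨i, j, rfl⟩ := hg
    obtain ⟨i', j', rfl⟩ := hk
    refine ⟨i + r ^ j * i', j + j', ?_⟩
    rw [mul_assoc, ← mul_assoc (y ^ j), pow_mul_pow_of_mul_eq_pow_mul h, pow_add, pow_add]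
    simp only [mul_assoc]
  | inv g _ hg =>
    obtain ⟨i, j, rfl⟩ := hg
    have inv_pow_eq {z : G} {c : ℕ} (hc : 0 < c) (hz : z ^ c = 1) (k : ℕ) :
        (z ^ k)⁻¹ = z ^ ((c - 1) * k) := by
      rw [inv_eq_iff_mul_eq_one, ← pow_add]
      rw [show k + (c - 1) * k = c * k by obtain ⟨c, rfl⟩ := Nat.exists_eq_add_of_lt hc; simp; ring,
        pow_mul, hz, one_pow]
    rw [mul_inv_rev, inv_pow_eq ha hx, inv_pow_eq hb hy, pow_mul_pow_of_mul_eq_pow_mul h]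
    exact ⟨_, _, rfl⟩

theorem finite_closure_pair_of_mul_eq_pow_mul {G : Type*} [Group G] {x y : G} {r a b : ℕ}
    (h : y * x = x ^ r * y) (ha : 0 < a) (hb : 0 < b) (hx : x ^ a = 1) (hy : y ^ b = 1) :
    Finite (Subgroup.closure {x, y}) := by
  refine Set.Finite.subset
    (((Finset.range a ×ˢ Finset.range b).finite_toSet).image fun t ↦ x ^ t.1 * y ^ t.2) ?_
  intro g hg
  obtain ⟨i, j, rfl⟩ := exists_eq_pow_mul_pow_of_mem_closure h ha hb hx hy hg
  refine ⟨(i % a, j % b), ?_, ?_⟩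
  · simp [Nat.mod_lt, ha, hb]
  · simp only
    rw [← pow_eq_pow_mod i hx, ← pow_eq_pow_mod j hy]

theorem dvd_geom_sum_of_pow_modEq_one {q s p : ℕ} (hq : q.Prime) (hs : s ^ p ≡ 1 [MOD q])
    (hs' : ¬ s ≡ 1 [MOD q]) : q ∣ ∑ l ∈ Finset.range p, s ^ l := by
  have := Fact.mk hq
  rw [← ZMod.natCast_eq_zero_iff]
  rw [← ZMod.natCast_eq_natCast_iff] at hs hs'
  push_cast at *
  have := geom_sum_mul (s : ZMod q) p
  rw [hs, sub_self, mul_eq_zero] at this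
  exact this.resolve_right (sub_ne_zero.2 hs')

theorem ZMod.exists_sum_eq_of_forall_ne_zero {p : ℕ} [Fact p.Prime] (hp : p ≠ 2) (m : ℕ)
    (t : ZMod p) : ∃ a : Fin (m + 2) → ZMod p, (∀ k, a k ≠ 0) ∧ ∑ k, a k = t := by
  induction m generalizing t with
  | zero =>
    obtain ⟨b, hb⟩ : ∃ b, b ∉ ({0, t} : Finset (ZMod p)) := by
      by_contra! H
      have h1 := Finset.card_le_card (fun b _ ↦ H b : Finset.univ ⊆ ({0, t} : Finset (ZMod p)))
      have h2 := Finset.card_le_two (a := (0 : ZMod p)) (b := t)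
      have h3 := (Fact.out : p.Prime).two_le
      rw [Finset.card_univ, ZMod.card] at h1
      omega
    simp only [Finset.mem_insert, Finset.mem_singleton, not_or] at hb
    refine ⟨![b, t - b], ?_, by simp⟩
    intro k
    fin_cases k
    · simpa using hb.1
    · simpa [sub_eq_zero] using Ne.symm hb.2
  | succ m ih =>
    obtain ⟨a, ha, hs⟩ := ih (t - 1)
    refine ⟨Fin.cons 1 a, ?_, by simp [Fin.sum_univ_succ (n := m + 2), hs]⟩
    intro k
    cases k using Fin.cases <;> simp [ha]

open Matrix in
theorem eval_one_charpoly_ne_zero {ι : Type*} [Fintype ι] [DecidableEq ι] (A : Matrix ι ι ℂ)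
    (h : ∀ v, A *ᵥ v = v → v = 0) : A.charpoly.eval 1 ≠ 0 := by
  rw [Matrix.eval_charpoly]
  intro h0
  obtain ⟨v, hv, hv0⟩ := Matrix.exists_mulVec_eq_zero_iff.2 h0
  refine hv (h v ?_)
  rw [Matrix.sub_mulVec] at hv0
  simpa using (sub_eq_zero.1 hv0).symm

open Matrix in
theorem pow_mulVec_eq_self {ι R : Type*} [Fintype ι] [DecidableEq ι] [CommRing R]
    {A : Matrix ι ι R} {v : ι → R} (h : A *ᵥ v = v) (k : ℕ) : (A ^ k) *ᵥ v = v := by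
  induction k with
  | zero => simp
  | succ k ih => rw [pow_succ, ← Matrix.mulVec_mulVec, h, ih]

open Matrix in
theorem exists_subgroup_specialLinearGroup_of_metacyclic {ι : Type*} [Fintype ι] [DecidableEq ι]
    [Nonempty ι] {p q r : ℕ} (hp : p.Prime) (hq : q.Prime) (hpq : p ≠ q)
    (hr : r ^ p ≡ 1 [MOD q]) (hr' : ¬ r ≡ 1 [MOD q])
    {X Y : SpecialLinearGroup ι ℂ} {z w : ι → ℂ}
    (hX : (X : Matrix ι ι ℂ) = diagonal z) (hY : (Y : Matrix ι ι ℂ) ^ p = diagonal w)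
    (hz : ∀ i, IsPrimitiveRoot (z i) q) (hw : ∀ i, IsPrimitiveRoot (w i) p)
    (hXY : Y * X = X ^ r * Y) :
    ∃ G : Subgroup (SpecialLinearGroup ι ℂ), Finite G ∧ ¬ IsCyclic G ∧
      ∀ g ∈ G, g ≠ 1 → (g : Matrix ι ι ℂ).charpoly.eval 1 ≠ 0 := by
  have hcoe (i j : ℕ) : ((X ^ i * Y ^ j : SpecialLinearGroup ι ℂ) : Matrix ι ι ℂ) =
      diagonal (z ^ i) * (Y : Matrix ι ι ℂ) ^ j := by
    rw [← diagonal_pow, ← hX]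
    rfl
  have hcoe' (i j : ℕ) : ((X ^ i * Y ^ (p * j) : SpecialLinearGroup ι ℂ) : Matrix ι ι ℂ) =
      diagonal (fun l ↦ z l ^ i * w l ^ j) := by
    rw [hcoe, pow_mul, hY, diagonal_pow, diagonal_mul_diagonal]
    rfl
  have hXq : X ^ q = 1 := by
    apply Subtype.ext
    have := hcoe' q 0
    rw [mul_zero, pow_zero, mul_one] at this
    change ((X ^ q : SpecialLinearGroup ι ℂ) : Matrix ι ι ℂ) = 1
    rw [this]
    simp [(hz _).pow_eq_one]
  have hYp : Y ^ (p * p) = 1 := by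
    apply Subtype.ext
    have := hcoe' 0 p
    rw [pow_zero, one_mul] at this
    change ((Y ^ (p * p) : SpecialLinearGroup ι ℂ) : Matrix ι ι ℂ) = 1
    rw [this]
    simp [(hw _).pow_eq_one]
  refine ⟨Subgroup.closure {X, Y}, finite_closure_pair_of_mul_eq_pow_mul hXY hq.pos
    (Nat.mul_pos hp.pos hp.pos) hXq hYp, fun hcyc ↦ hr' ?_, fun g hg hg1 ↦ ?_⟩
  · have hcomm := congrArg Subtype.val (hcyc.isMulCommutative.is_comm.comm
      (⟨X, Subgroup.subset_closure (by simp)⟩ : Subgroup.closure {X, Y})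
      ⟨Y, Subgroup.subset_closure (by simp)⟩)
    simp only [Subgroup.coe_mul] at hcomm
    have hXr : X ^ r = X ^ 1 := by
      rw [← hcomm] at hXY
      rw [pow_one]
      exact (mul_right_cancel hXY).symm
    have hXr' := congrArg Subtype.val hXr
    have hcoeX (i : ℕ) := hcoe i 0
    simp only [pow_zero, mul_one] at hcoeX
    rw [hcoeX, hcoeX] at hXr'
    obtain ⟨i⟩ := ‹Nonempty ι›
    have hi := congrFun (diagonal_injective hXr') i
    simp only [Pi.pow_apply] at hi
    rw [pow_eq_pow_mod r (hz i).pow_eq_one, pow_eq_pow_mod 1 (hz i).pow_eq_one] at hi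
    exact (hz i).pow_inj (Nat.mod_lt _ hq.pos) (Nat.mod_lt _ hq.pos) hi
  · obtain ⟨i, j, rfl⟩ := exists_eq_pow_mul_pow_of_mem_closure hXY hq.pos
      (Nat.mul_pos hp.pos hp.pos) hXq hYp hg
    refine eval_one_charpoly_ne_zero _ fun v hv ↦ ?_
    by_cases hj : p ∣ j
    · obtain ⟨k, rfl⟩ := hj
      rw [hcoe'] at hv
      ext l
      by_contra hl
      have h1 : z l ^ i * w l ^ k = 1 := by
        have := congrFun hv l
        rw [mulVec_diagonal] at this
        exact mul_right_cancel₀ hl (this.trans (one_mul _).symm)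
      have hqi : q ∣ i := by
        have h2 : z l ^ (i * p) = 1 := by
          have := congrArg (· ^ p) h1
          simpa [mul_pow, ← pow_mul, mul_comm k p, pow_mul (w l) p, (hw l).pow_eq_one] using this
        exact (hq.dvd_mul.1 ((hz l).dvd_of_pow_eq_one _ h2)).resolve_right
          fun h ↦ hpq ((Nat.prime_dvd_prime_iff_eq hq hp).1 h).symm
      rw [((hz l).pow_eq_one_iff_dvd i).2 hqi, one_mul] at h1
      obtain ⟨a, rfl⟩ := hqi
      obtain ⟨b, rfl⟩ := (hw l).dvd_of_pow_eq_one _ h1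
      exact hg1 (by rw [pow_mul, hXq, ← mul_assoc, pow_mul Y, hYp, one_pow, one_pow, one_mul])
    · have hs : ¬ r ^ j ≡ 1 [MOD q] := fun h ↦ hj <| by
        have := Fact.mk hp
        rw [← ZMod.natCast_eq_natCast_iff, Nat.cast_one] at h hr hr'
        push_cast at h hr
        rw [← orderOf_eq_prime hr hr']
        exact orderOf_dvd_of_pow_eq_one h
      obtain ⟨a, ha⟩ := dvd_geom_sum_of_pow_modEq_one (p := p) hq
        (by rw [← pow_mul, mul_comm, pow_mul]; simpa using hr.pow j) hs
      have hpow : ((X ^ i * Y ^ j) ^ p).val *ᵥ v = v := pow_mulVec_eq_self hv p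
      rw [pow_mul_pow_pow_of_mul_eq_pow_mul hXY, ha, mul_left_comm, pow_mul X, hXq, one_pow,
        ← pow_zero X, mul_comm j, hcoe'] at hpow
      ext l
      by_contra hl
      have h1 : w l ^ j = 1 := by
        have := congrFun hpow l
        rw [mulVec_diagonal, pow_zero, one_mul] at this
        exact mul_right_cancel₀ hl (this.trans (one_mul _).symm)
      exact hj ((hw l).dvd_of_pow_eq_one _ h1)

open Matrix in
theorem permMatrix_mul_diagonal {ι R : Type*} [Fintype ι] [DecidableEq ι] [CommRing R]
    (σ : Equiv.Perm ι) (d : ι → R) :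
    σ.permMatrix R * diagonal d = diagonal (d ∘ σ) * σ.permMatrix R := by
  ext i j
  rw [mul_diagonal, diagonal_mul]
  by_cases h : σ i = j
  · simp [← h]
  · simp [PEquiv.toMatrix_apply, h]

open Matrix in
theorem exists_subgroup_specialLinearGroup_of_perm {ι : Type*} [Fintype ι] [DecidableEq ι]
    [Nonempty ι] {p q r : ℕ} (hp : p.Prime) (hq : q.Prime) (hpq : p ≠ q)
    (hr : r ^ p ≡ 1 [MOD q]) (hr' : ¬ r ≡ 1 [MOD q])
    {σ : Equiv.Perm ι} {z η : ι → ℂ} (hσ : σ ^ p = 1)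
    (hz : ∀ i, IsPrimitiveRoot (z i) q) (hη : ∀ i, IsPrimitiveRoot (η i ^ p) p)
    (hzσ : ∀ i, z (σ i) = z i ^ r) (hησ : ∀ i, η (σ i) = η i)
    (hzdet : ∏ i, z i = 1) (hηdet : (∏ i, η i) * (Equiv.Perm.sign σ : ℤ) = 1) :
    ∃ G : Subgroup (SpecialLinearGroup ι ℂ), Finite G ∧ ¬ IsCyclic G ∧
      ∀ g ∈ G, g ≠ 1 → (g : Matrix ι ι ℂ).charpoly.eval 1 ≠ 0 := by
  have hperm (k : ℕ) : σ.permMatrix ℂ ^ k = (σ ^ k).permMatrix ℂ := by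
    induction k with
    | zero => simp
    | succ k ih => rw [pow_succ, ih, pow_succ', permMatrix_mul]
  have hcomm : Commute (diagonal η) (σ.permMatrix ℂ) := by
    have := permMatrix_mul_diagonal σ η
    rw [show η ∘ σ = η from funext hησ] at this
    exact this.symm
  refine exists_subgroup_specialLinearGroup_of_metacyclic hp hq hpq hr hr'
    (X := ⟨diagonal z, by rw [det_diagonal, hzdet]⟩)
    (Y := ⟨diagonal η * σ.permMatrix ℂ, by
      rw [det_mul, det_diagonal, det_permutation, hηdet]⟩) (z := z) (w := η ^ p) rfl ?_ hz hη ?_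
  · rw [hcomm.mul_pow, hperm, hσ, diagonal_pow]
    simp
  · apply Subtype.ext
    change diagonal η * σ.permMatrix ℂ * diagonal z = diagonal z ^ r * (diagonal η * σ.permMatrix ℂ)
    rw [mul_assoc, permMatrix_mul_diagonal, show z ∘ σ = z ^ r from funext hzσ, diagonal_pow,
      ← mul_assoc, ← mul_assoc, diagonal_mul_diagonal', diagonal_mul_diagonal']
    simp only [mul_comm]

/-- Exponents of primitive `p ^ 2`-th roots of unity making the determinant equal to one. -/
theorem exists_exponents {p m : ℕ} (hp : p.Prime) (hm : m ≠ 0) (hpm : p ≠ 2 → m ≠ 1) :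
    ∃ a : Fin m → ℕ, (∀ k, (a k).Coprime p) ∧ (p = 2 → ∀ k, a k = 1) ∧
      (p ≠ 2 → p ∣ ∑ k, a k) := by
  have := Fact.mk hp
  by_cases h2 : p = 2
  · exact ⟨fun _ ↦ 1, by simp, by simp, by simp [h2]⟩
  · obtain ⟨m, rfl⟩ : ∃ k, m = k + 2 := ⟨m - 2, by have := hpm h2; omega⟩
    obtain ⟨a, ha, hsum⟩ := ZMod.exists_sum_eq_of_forall_ne_zero h2 m 0
    refine ⟨fun k ↦ (a k).val, fun k ↦ ?_, fun h ↦ absurd h h2, fun _ ↦ ?_⟩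
    · exact (ZMod.isUnit_iff_coprime _ _).1 (by simpa using ha k)
    · rw [← ZMod.natCast_eq_zero_iff]
      simpa using hsum

theorem exists_prime_and_pow_modEq_one {p : ℕ} (hp : p.Prime) :
    ∃ q r : ℕ, q.Prime ∧ p ≠ q ∧ r ^ p ≡ 1 [MOD q] ∧ ¬ r ≡ 1 [MOD q] := by
  obtain ⟨q, hq, hpq, hq1⟩ := Nat.exists_prime_gt_modEq_one p hp.ne_zero
  have := Fact.mk hq
  have := Fact.mk hp
  have hdvd : p ∣ Fintype.card (ZMod q)ˣ := by
    rw [ZMod.card_units]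
    exact (Nat.modEq_iff_dvd' hq.one_le).1 hq1.symm
  obtain ⟨u, hu⟩ := exists_prime_orderOf_dvd_card p hdvd
  refine ⟨q, (u : ZMod q).val, hq, hpq.ne, ?_, ?_⟩
  · rw [← ZMod.natCast_eq_natCast_iff]
    have := pow_orderOf_eq_one u
    rw [hu] at this
    simpa using congrArg Units.val this
  · rw [← ZMod.natCast_eq_natCast_iff]
    intro h
    have h1 : u = 1 := by
      ext
      simpa using h
    rw [h1, orderOf_one] at hu
    exact hp.one_lt.ne hu

/-- If `n > 1` is not an odd prime number, then there exists a finite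
*non-cyclic* subgroup `G` of `SL(n, ℂ)` such that `1` is not an eigenvalue
(root of the characteristic polynomial) of any matrix in `G` except the
identity. -/
theorem stmt15 (n : ℕ) (hn : 1 < n) (hnp : ¬ (n.Prime ∧ Odd n)) :
    ∃ G : Subgroup (Matrix.SpecialLinearGroup (Fin n) ℂ),
      Finite G ∧
      ¬ IsCyclic G ∧
      ∀ g ∈ G, g ≠ 1 →
        Polynomial.eval 1 (Matrix.charpoly (g : Matrix (Fin n) (Fin n) ℂ)) ≠ 0 := by
  obtain ⟨p, m, hp, hnpm, hm, hpm⟩ :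
      ∃ p m : ℕ, p.Prime ∧ n = m * p ∧ m ≠ 0 ∧ (p ≠ 2 → m ≠ 1) := by
    have hp := Nat.minFac_prime hn.ne'
    obtain ⟨m, hm⟩ := Nat.minFac_dvd n
    refine ⟨n.minFac, m, hp, by rw [mul_comm]; exact hm, ?_, ?_⟩
    · rintro rfl
      omega
    · rintro h2 rfl
      rw [mul_one] at hm
      rw [← hm] at hp h2
      exact hnp ⟨hp, hp.odd_of_ne_two h2⟩
  have := Fact.mk hp
  have : Nonempty (Fin n) := ⟨⟨0, by omega⟩⟩
  obtain ⟨q, r, hq, hpq, hr, hr'⟩ := exists_prime_and_pow_modEq_one hp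
  obtain ⟨a, ha, ha2, hap⟩ := exists_exponents hp hm hpm
  have f : Fin n ≃ Fin m × ZMod p := Fintype.equivOfCardEq (by simp [hnpm, ZMod.card])
  have hζ := Complex.isPrimitiveRoot_exp q hq.ne_zero
  have hθ := Complex.isPrimitiveRoot_exp (p * p) (Nat.mul_pos hp.pos hp.pos).ne'
  set ζ := Complex.exp (2 * Real.pi * Complex.I / q)
  set θ := Complex.exp (2 * Real.pi * Complex.I / (p * p : ℕ))
  have hθp : IsPrimitiveRoot (θ ^ p) p := hθ.pow (Nat.mul_pos hp.pos hp.pos) rfl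
  have hrq : r.Coprime q := by
    have := hr.gcd_eq
    rw [Nat.gcd_one_left] at this
    exact (Nat.coprime_pow_left_iff hp.pos _ _).1 this
  have hζpow {b c : ℕ} (h : b ≡ c [MOD q]) : ζ ^ b = ζ ^ c := by
    rw [pow_eq_pow_mod b hζ.pow_eq_one, pow_eq_pow_mod c hζ.pow_eq_one, show b % q = c % q from h]
  let τ : Equiv.Perm (Fin m × ZMod p) := Equiv.prodCongrRight fun _ ↦ Equiv.addRight 1
  have hτ (k : ℕ) (x : Fin m × ZMod p) : (τ ^ k) x = (x.1, x.2 + k) := by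
    induction k with
    | zero => simp
    | succ k ih => simp [pow_succ', ih, τ, add_assoc]
  let σ : Equiv.Perm (Fin n) := f.symm.permCongr τ
  have hσ (k : ℕ) : σ ^ k = f.symm.permCongr (τ ^ k) :=
    (map_pow f.symm.permCongrHom τ k).symm
  have hσp : σ ^ p = 1 := by
    rw [hσ]
    ext i
    simp [hτ]
  have hfσ (i : Fin n) : f (σ i) = ((f i).1, (f i).2 + 1) := by
    simpa [σ] using hτ 1 (f i)
  refine exists_subgroup_specialLinearGroup_of_perm hp hq hpq hr hr' (σ := σ)
    (z := fun i ↦ ζ ^ (r ^ (f i).2.val)) (η := fun i ↦ θ ^ a (f i).1) hσp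
    (fun i ↦ hζ.pow_of_coprime _ (hrq.pow_left _)) (fun i ↦ ?_) (fun i ↦ ?_) (fun i ↦ ?_) ?_ ?_
  · rw [pow_right_comm]
    exact hθp.pow_of_coprime _ (ha _)
  · rw [hfσ, ← pow_mul, ← pow_succ]
    apply hζpow
    rw [← ZMod.natCast_eq_natCast_iff] at hr ⊢
    push_cast at hr ⊢
    rw [ZMod.val_add, ZMod.val_one, ← pow_eq_pow_mod _ hr]
  · rw [hfσ]
  · rw [f.prod_comp (fun x ↦ ζ ^ r ^ x.2.val), Fintype.prod_prod_type]
    refine Finset.prod_eq_one fun k _ ↦ ?_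
    rw [Finset.prod_pow_eq_pow_sum]
    rw [hζ.pow_eq_one_iff_dvd]
    convert dvd_geom_sum_of_pow_modEq_one hq hr hr' using 1
    refine Finset.sum_bij (fun x _ ↦ x.val) (by simp [ZMod.val_lt])
      (fun x _ y _ h ↦ ZMod.val_injective p h) (fun b hb ↦ ?_) (fun _ _ ↦ rfl)
    exact ⟨b, Finset.mem_univ _, ZMod.val_cast_of_lt (Finset.mem_range.1 hb)⟩
  · rw [f.prod_comp (fun x ↦ θ ^ a x.1), Fintype.prod_prod_type]
    simp only [Finset.prod_const, Finset.card_univ, ZMod.card, pow_right_comm _ _ p,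
      Finset.prod_pow_eq_pow_sum]
    by_cases h2 : p = 2
    · subst h2
      have hsign : Equiv.Perm.sign σ = (-1) ^ m := by
        rw [Equiv.Perm.sign_permCongr, Equiv.Perm.sign_prodCongrRight, Finset.prod_const,
          Finset.card_univ, Fintype.card_fin]
        congr 1
      rw [hsign, hθp.eq_neg_one_of_two_right]
      simp [ha2, ← mul_pow]
    · have hsign : Equiv.Perm.sign σ = 1 := by
        have := congrArg Equiv.Perm.sign hσp
        rw [map_pow, Int.units_pow_eq_pow_mod_two, Nat.odd_iff.1 (hp.odd_of_ne_two h2)] at this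
        simpa using this
      rw [hsign, (hθp.pow_eq_one_iff_dvd _).2 (hap h2)]
      simp
end

section
/- Let n be an odd prime number and K an algebraically closed field whose characteristic is 0 or does not divide the order of G. Let G be a finite subgroup of SL(n, K) such that 1 is not an eigenvalue of any matrix in G except the identity matrix. Let a ∈ G be an element of order s, and let b ∈ G and u an integer such that b⁻¹ab = a^u. Then u ≡ 1 (mod s); in particular a and b commute. -/
open Polynomial in
/-- The determinant of a polynomial in a matrix is the product of the values of the polynomial at
the roots of the characteristic polynomial. -/
theorem Matrix.det_aeval_eq_prod_roots {K ι : Type*} [Field K] [IsAlgClosed K] [Fintype ι]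
    [DecidableEq ι] (A : Matrix ι ι K) (q : K[X]) :
    (aeval A q).det = (A.charpoly.roots.map fun r => q.eval r).prod := by
  have hcard : A.charpoly.roots.card = Fintype.card ι := by
    rw [← (IsAlgClosed.splits A.charpoly).natDegree_eq_card_roots]
    exact A.charpoly_natDegree_eq_dim
  have hlin (c : K) : (aeval A (X - C c)).det = (A.charpoly.roots.map fun r => r - c).prod := by
    have h1 : aeval A (X - C c) = -(Matrix.scalar ι c - A) := by
      simp [Matrix.algebraMap_eq_diagonal]
    rw [h1, Matrix.det_neg, ← Matrix.eval_charpoly]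
    nth_rewrite 1 [(IsAlgClosed.splits A.charpoly).eq_prod_roots_of_monic A.charpoly_monic]
    rw [eval_multiset_prod, Multiset.map_map, ← hcard]
    have h2 : ((A.charpoly.roots.map fun r => r - c).map Neg.neg).prod =
        (A.charpoly.roots.map ((eval c) ∘ fun r => X - C r)).prod := by
      rw [Multiset.map_map]
      congr 2
      funext r
      simp
    rw [← h2, Multiset.prod_map_neg, Multiset.card_map, ← mul_assoc, ← mul_pow]
    simp
  have hprod (s : Multiset K) : (aeval A (s.map fun c => X - C c).prod).det =
      (A.charpoly.roots.map fun r => (s.map fun c => X - C c).prod.eval r).prod := by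
    induction s using Multiset.induction_on with
    | empty => simp
    | cons c s ih =>
      simp only [Multiset.map_cons, Multiset.prod_cons, map_mul, Matrix.det_mul, ih, eval_mul,
        Multiset.prod_map_mul, hlin]
      simp
  rw [(IsAlgClosed.splits q).eq_prod_roots, map_mul, Matrix.det_mul, hprod]
  simp [eval_mul, Multiset.prod_map_mul, Matrix.algebraMap_eq_diagonal, hcard]

open Polynomial in
/-- The roots of the characteristic polynomial of `A ^ k` are the `k`-th powers of those of `A`. -/
theorem Matrix.roots_charpoly_pow {K ι : Type*} [Field K] [IsAlgClosed K] [Fintype ι]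
    [DecidableEq ι] (A : Matrix ι ι K) (k : ℕ) :
    (A ^ k).charpoly.roots = A.charpoly.roots.map (· ^ k) := by
  have h : (A ^ k).charpoly = ((A.charpoly.roots.map (· ^ k)).map fun r => X - C r).prod := by
    refine Polynomial.funext fun t => ?_
    have h1 : Matrix.scalar ι t - A ^ k = aeval A (C t - X ^ k) := by
      simp [Matrix.algebraMap_eq_diagonal]
    rw [Matrix.eval_charpoly, h1, Matrix.det_aeval_eq_prod_roots, eval_multiset_prod]
    simp [Multiset.map_map]
  rw [h, roots_multiset_prod_X_sub_C]

/-- If a self-map permutes a multiset with all points of prime period `p`, then `p` divides the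
cardinality of the multiset. -/
theorem Multiset.prime_dvd_card_of_map_eq {α : Type*} [DecidableEq α] (R : Multiset α) (f : α → α)
    {p : ℕ} (hp : p.Prime) (hmap : R.map f = R) (hper : ∀ x ∈ R, f^[p] x = x)
    (hfix : ∀ x ∈ R, f x ≠ x) : p ∣ R.card := by
  have : Fact p.Prime := ⟨hp⟩
  have hinj : Set.InjOn f {x | x ∈ R} := by
    intro x hx y hy hxy
    rw [← hper x hx, ← hper y hy, ← Nat.sub_add_cancel hp.one_le, Function.iterate_add_apply,
      Function.iterate_add_apply, Function.iterate_one, hxy]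
  have hcount (x : α) (hx : x ∈ R) : R.count x = R.count (f x) := by
    conv_rhs => rw [← hmap]
    exact (Multiset.count_map_eq_count f R hinj x hx).symm
  have hmem (z : R.ToType) : z.1 ∈ R := Multiset.count_pos.mp (z.2.pos)
  let F : Function.End R.ToType := fun z => ⟨f z.1, Fin.cast (hcount z.1 (hmem z)) z.2⟩
  have hF (k : ℕ) (z : R.ToType) :
      ((F ^ k) z).1 = f^[k] z.1 ∧ (((F ^ k) z).2 : ℕ) = z.2 := by
    induction k with
    | zero => exact ⟨rfl, rfl⟩
    | succ k ih =>
      rw [pow_succ', Function.iterate_succ_apply', ← ih.1, ← ih.2]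
      exact ⟨rfl, rfl⟩
  classical
  have hF1 : F ^ p ^ 1 = 1 := by
    rw [pow_one]
    funext z
    obtain ⟨h1, h2⟩ := hF p z
    rw [hper _ (hmem z)] at h1
    refine Sigma.ext h1 ?_
    exact (Fin.heq_ext_iff (by rw [h1]; rfl)).2 h2
  have hempty : IsEmpty (Function.fixedPoints F) :=
    ⟨fun z => hfix _ (hmem z.1) (congrArg Sigma.fst z.2)⟩
  have hmod : Fintype.card R.ToType ≡ 0 [MOD p] :=
    (Equiv.Perm.card_fixedPoints_modEq hF1).trans
      (congrArg (· % p) (Fintype.card_eq_zero_iff.2 hempty))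
  rw [Multiset.card_coe] at hmod
  exact (Nat.modEq_zero_iff_dvd).1 hmod

/-- In a group, if `b` has finite order and does not commute with `a`, some power of `b` does not
commute with `a` but has a prime power which does. -/
theorem exists_pow_not_commute_of_prime {G : Type*} [Group G] {a b : G} (hb : IsOfFinOrder b)
    (hab : ¬ Commute a b) :
    ∃ k p : ℕ, p.Prime ∧ ¬ Commute a (b ^ k) ∧ Commute a ((b ^ k) ^ p) := by
  classical
  have hex : ∃ d : ℕ, 0 < d ∧ Commute a (b ^ d) :=
    ⟨orderOf b, hb.orderOf_pos, by rw [pow_orderOf_eq_one]; exact Commute.one_right a⟩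
  obtain ⟨hd, hcomm⟩ := Nat.find_spec hex
  have hmin (m : ℕ) (hm : m < Nat.find hex) : ¬ (0 < m ∧ Commute a (b ^ m)) := Nat.find_min hex hm
  generalize Nat.find hex = d at *
  have hd1 : d ≠ 1 := by
    rintro rfl
    exact hab (by simpa using hcomm)
  have hp := Nat.minFac_prime hd1
  refine ⟨d / d.minFac, d.minFac, hp, fun h => ?_, ?_⟩
  · exact hmin _ (Nat.div_lt_self hd hp.one_lt)
      ⟨Nat.div_pos (Nat.minFac_le hd) hp.pos, h⟩
  · rwa [← pow_mul, Nat.div_mul_cancel d.minFac_dvd]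

open Polynomial Matrix in
/-- If `v, B v, …, B^{n-1} v` are eigenvectors of an endomorphism for distinct eigenvalues and
`B^n v` has the same eigenvalue as `v`, where `n` is odd and `det B = 1`, then `1` is a root of the
characteristic polynomial of `B`. -/
theorem Matrix.eval_one_charpoly_eq_zero_of_cyclic {K : Type*} [Field K] {n : ℕ} (hodd : Odd n)
    (A B : Matrix (Fin n) (Fin n) K) (hB : B.det = 1) (v : Fin n → K) (hv : v ≠ 0) (μ : ℕ → K)
    (hμ : ∀ i, A *ᵥ (B ^ i *ᵥ v) = μ i • (B ^ i *ᵥ v))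
    (hinj : Set.InjOn μ (Set.Iio n)) (hn : μ n = μ 0) : eval 1 B.charpoly = 0 := by
  have hunit : IsUnit B := by rw [Matrix.isUnit_iff_isUnit_det, hB]; exact isUnit_one
  have hne (i : ℕ) : B ^ i *ᵥ v ≠ 0 := fun h =>
    hv (Matrix.mulVec_injective_of_isUnit (hunit.pow i) (by simpa using h))
  have hli : LinearIndependent K fun i : Fin n => B ^ (i : ℕ) *ᵥ v := by
    refine Module.End.eigenvectors_linearIndependent' (Matrix.toLin' A) (fun i : Fin n => μ i) ?_
      (fun i : Fin n => B ^ (i : ℕ) *ᵥ v) ?_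
    · exact fun i j h => Fin.ext (hinj i.2 j.2 h)
    · intro i
      refine ⟨Module.End.mem_eigenspace_iff.2 ?_, hne i⟩
      rw [Matrix.toLin'_apply, hμ]
  have hdeg : B.charpoly.natDegree = n := by simp
  have hlead : B.charpoly.coeff n = 1 := by
    have := B.charpoly_monic.coeff_natDegree
    rwa [hdeg] at this
  have hsum : ∑ i : Fin n, B.charpoly.coeff i • (B ^ (i : ℕ) *ᵥ v) + B ^ n *ᵥ v = 0 := by
    have h := congrArg (· *ᵥ v) (Matrix.aeval_self_charpoly B)
    simp only [aeval_eq_sum_range, hdeg, Matrix.zero_mulVec, Matrix.sum_mulVec,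
      Matrix.smul_mulVec] at h
    rw [Finset.sum_range_succ, Finset.sum_range, hlead, one_smul] at h
    exact h
  have hcoeff (i : Fin n) (hi : (i : ℕ) ≠ 0) : B.charpoly.coeff i = 0 := by
    have h1 := congrArg (A *ᵥ ·) hsum
    simp only [Matrix.mulVec_add, Matrix.mulVec_sum, Matrix.mulVec_smul, hμ, hn,
      Matrix.mulVec_zero] at h1
    have h2 : ∑ i : Fin n, (B.charpoly.coeff i * (μ i - μ 0)) • (B ^ (i : ℕ) *ᵥ v) = 0 := by
      have h3 := congrArg (μ 0 • ·) hsum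
      simp only [smul_add, Finset.smul_sum, smul_zero] at h3
      rw [← sub_eq_zero.2 (h1.trans h3.symm), add_sub_add_right_eq_sub, ← Finset.sum_sub_distrib]
      refine Finset.sum_congr rfl fun i _ => ?_
      module
    have h4 := Fintype.linearIndependent_iff.1 hli _ h2 i
    refine (mul_eq_zero.1 h4).resolve_right fun h => hi ?_
    exact hinj i.2 (Set.mem_Iio.2 i.pos) (sub_eq_zero.1 h)
  have hzero : B.charpoly.coeff 0 = -1 := by
    have h := Matrix.det_eq_sign_charpoly_coeff B
    rw [hB, Fintype.card_fin, hodd.neg_one_pow] at h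
    linear_combination h
  obtain ⟨m, rfl⟩ : ∃ m, n = m + 1 := ⟨n - 1, by have := hodd.pos; omega⟩
  rw [eval_eq_sum_range, hdeg, Finset.sum_range_succ, hlead, Finset.sum_range, Fin.sum_univ_succ]
  rw [Finset.sum_eq_zero fun i _ => by rw [hcoeff i.succ (by simp), zero_mul]]
  simp [hzero]

open Polynomial Matrix in
/-- In a finite subgroup of `SL(n, K)`, `n` an odd prime, whose nontrivial elements do not have the
eigenvalue `1`, elements which normalize a cyclic subgroup centralize it. -/
theorem Matrix.SpecialLinearGroup.commute_of_conj_eq_pow {n : ℕ} (hp : n.Prime) (hodd : Odd n)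
    {K : Type*} [Field K] [IsAlgClosed K]
    (G : Subgroup (Matrix.SpecialLinearGroup (Fin n) K)) [Finite G]
    (h1 : ∀ g ∈ G, g ≠ 1 → eval 1 (Matrix.charpoly (g : Matrix (Fin n) (Fin n) K)) ≠ 0)
    {a b : Matrix.SpecialLinearGroup (Fin n) K} (ha : a ∈ G) (hb : b ∈ G)
    {u : ℕ} (hu : a * b = b * a ^ u) : Commute a b := by
  by_contra hab
  classical
  have hfina : IsOfFinOrder a :=
    Submonoid.isOfFinOrder_coe.2 (isOfFinOrder_of_finite (⟨a, ha⟩ : G))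
  have hfinb : IsOfFinOrder b :=
    Submonoid.isOfFinOrder_coe.2 (isOfFinOrder_of_finite (⟨b, hb⟩ : G))
  obtain ⟨k, p, hpp, hk, hkp⟩ := exists_pow_not_commute_of_prime hfinb hab
  have hiter (b : Matrix.SpecialLinearGroup (Fin n) K) (u : ℕ) (h : a * b = b * a ^ u) (i : ℕ) :
      a * b ^ i = b ^ i * a ^ u ^ i := by
    have hs : SemiconjBy b (a ^ u) a := h.symm
    induction i with
    | zero => simp
    | succ i ih =>
      have hi : SemiconjBy (b ^ i) (a ^ u ^ i) a := ih.symm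
      have := hi.mul_left (hs.pow_right (u ^ i))
      rw [← pow_mul, ← pow_succ', ← pow_succ] at this
      exact this.symm
  have huk := hiter b u hu k
  have hbk : b ^ k ∈ G := pow_mem hb k
  generalize b ^ k = c at *
  generalize u ^ k = w at *
  have hpow := hiter c w huk
  have hwp : a ^ w ^ p = a := by
    have := hpow p
    rw [hkp.eq] at this
    exact (mul_left_cancel this).symm
  have hw : a ^ w ≠ a := fun h => hk (by rw [h] at huk; exact huk)
  set A : Matrix (Fin n) (Fin n) K := a.val with hA
  set C : Matrix (Fin n) (Fin n) K := c.val with hC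
  have horder (x : K) (hx : x ∈ A.charpoly.roots) : orderOf x = orderOf a := by
    refine orderOf_eq_orderOf_iff.2 fun m => ?_
    have hm : x ^ m ∈ ((a ^ m : Matrix.SpecialLinearGroup (Fin n) K) :
        Matrix (Fin n) (Fin n) K).charpoly.roots := by
      rw [Matrix.SpecialLinearGroup.coe_pow, Matrix.roots_charpoly_pow]
      exact Multiset.mem_map_of_mem _ hx
    constructor
    · intro h
      by_contra hne
      rw [h] at hm
      exact h1 _ (pow_mem ha m) hne (isRoot_of_mem_roots hm)
    · intro h
      rw [h, Matrix.SpecialLinearGroup.coe_one, Matrix.charpoly_one] at hm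
      have := isRoot_of_mem_roots hm
      rw [IsRoot, eval_pow] at this
      have := eq_zero_of_pow_eq_zero this
      simpa [sub_eq_zero] using this
  have hiff (x : K) (hx : x ∈ A.charpoly.roots) (i j : ℕ) : x ^ i = x ^ j ↔ a ^ i = a ^ j := by
    have hx0 : x ≠ 0 := by
      rintro rfl
      have hpos := hfina.orderOf_pos
      have h0 := pow_orderOf_eq_one (0 : K)
      rw [horder 0 hx, zero_pow hpos.ne'] at h0
      exact zero_ne_one h0
    lift x to Kˣ using hx0.isUnit
    rw [← Units.val_pow_eq_pow_val, ← Units.val_pow_eq_pow_val, Units.val_inj,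
      pow_eq_pow_iff_modEq, pow_eq_pow_iff_modEq, ← orderOf_units, horder x hx]
  have hit (x : K) (i : ℕ) : (fun y : K => y ^ w)^[i] x = x ^ w ^ i := by
    rw [pow_iterate]
  have hper (x : K) (hx : x ∈ A.charpoly.roots) : (fun y : K => y ^ w)^[p] x = x := by
    rw [hit]
    nth_rewrite 2 [← pow_one x]
    rw [hiff x hx, hwp, pow_one]
  have hfix (x : K) (hx : x ∈ A.charpoly.roots) : x ^ w ≠ x := by
    intro h
    nth_rewrite 2 [← pow_one x] at h
    rw [hiff x hx, pow_one] at h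
    exact hw h
  have hmap : A.charpoly.roots.map (fun y : K => y ^ w) = A.charpoly.roots := by
    rw [← Matrix.roots_charpoly_pow]
    have h1 : a = c * (a ^ w * c⁻¹) := by rw [← mul_assoc, ← huk, mul_inv_cancel_right]
    have h2 : A = C * (a ^ w * c⁻¹).val := congrArg Subtype.val h1
    have h3 : (a ^ w * c⁻¹).val * C = A ^ w := by
      rw [hC, ← Matrix.SpecialLinearGroup.coe_mul, inv_mul_cancel_right,
        Matrix.SpecialLinearGroup.coe_pow]
    conv_rhs => rw [h2, Matrix.charpoly_mul_comm, h3]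
  have hcard : A.charpoly.roots.card = n := by
    rw [← (IsAlgClosed.splits A.charpoly).natDegree_eq_card_roots]
    simp
  have hdvd := Multiset.prime_dvd_card_of_map_eq _ _ hpp hmap hper hfix
  rw [hcard, Nat.prime_dvd_prime_iff_eq hpp hp] at hdvd
  subst hdvd
  obtain ⟨x, hx⟩ := Multiset.card_pos_iff_exists_mem.1 (hcard ▸ hpp.pos)
  have hdet : (Matrix.scalar (Fin p) x - A).det = 0 := by
    rw [← Matrix.eval_charpoly]
    exact isRoot_of_mem_roots hx
  obtain ⟨v, hv, hvx⟩ := Matrix.exists_mulVec_eq_zero_iff.2 hdet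
  have hAv : A *ᵥ v = x • v := by
    rw [Matrix.sub_mulVec, sub_eq_zero] at hvx
    rw [← hvx, Matrix.scalar_apply, ← Matrix.smul_one_eq_diagonal, Matrix.smul_mulVec, Matrix.one_mulVec]
  have hApow (m : ℕ) : A ^ m *ᵥ v = x ^ m • v := by
    induction m with
    | zero => simp
    | succ m ih =>
      rw [pow_succ, ← Matrix.mulVec_mulVec, hAv, Matrix.mulVec_smul, ih, smul_smul, pow_succ']
  have : Fact p.Prime := ⟨hpp⟩
  have hmin : Function.minimalPeriod (fun y : K => y ^ w) x = p :=
    Function.minimalPeriod_eq_prime (hper x hx) (hfix x hx)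
  refine h1 c hbk (fun h => hk (h ▸ Commute.one_right a)) ?_
  refine Matrix.eval_one_charpoly_eq_zero_of_cyclic hodd A C c.det_coe v hv
    (fun i => x ^ w ^ i) (fun i => ?_) ?_ ?_
  · have hi := congrArg (Subtype.val) (hpow i)
    simp only [Matrix.SpecialLinearGroup.coe_mul, Matrix.SpecialLinearGroup.coe_pow] at hi
    rw [Matrix.mulVec_mulVec, hA, hC, hi, ← Matrix.mulVec_mulVec, hApow, Matrix.mulVec_smul]
  · have := Function.iterate_injOn_Iio_minimalPeriod (f := fun y : K => y ^ w) (x := x)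
    rw [hmin] at this
    simpa only [hit] using this
  · have := hper x hx
    rw [hit] at this
    simpa using this


/-- Let `n` be an odd prime, `K` an algebraically closed field, and `G` a finite
subgroup of `SL(n, K)` whose order is invertible in `K` such that `1` is not an
eigenvalue (root of the characteristic polynomial) of any matrix in `G` except
the identity.  If `a ∈ G` has order `s` and `b ∈ G`, `u ∈ ℤ` satisfy
`b⁻¹ * a * b = a ^ u`, then `u ≡ 1 (mod s)`; in particular `a` and `b`
commute. -/
theorem stmt16 (n : ℕ) (hp : n.Prime) (hodd : Odd n) (K : Type*) [Field K] [IsAlgClosed K]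
    (G : Subgroup (Matrix.SpecialLinearGroup (Fin n) K)) [Finite G]
    (hchar : (Nat.card G : K) ≠ 0)
    (h1 : ∀ g ∈ G, g ≠ 1 →
      Polynomial.eval 1 (Matrix.charpoly (g : Matrix (Fin n) (Fin n) K)) ≠ 0)
    (a b : Matrix.SpecialLinearGroup (Fin n) K) (ha : a ∈ G) (hb : b ∈ G)
    (s : ℕ) (hs : orderOf a = s) (u : ℤ) (hu : b⁻¹ * a * b = a ^ u) :
    u ≡ 1 [ZMOD (s : ℤ)] ∧ a * b = b * a := by
  have hfin : IsOfFinOrder a :=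
    Submonoid.isOfFinOrder_coe.2 (isOfFinOrder_of_finite (⟨a, ha⟩ : G))
  have hpos : (0 : ℤ) < orderOf a := by exact_mod_cast hfin.orderOf_pos
  have hnat : a ^ u = a ^ (u % orderOf a).toNat := by
    rw [← zpow_natCast, Int.toNat_of_nonneg (Int.emod_nonneg _ hpos.ne'), zpow_mod_orderOf]
  have hcomm : a * b = b * a :=
    Matrix.SpecialLinearGroup.commute_of_conj_eq_pow hp hodd G h1 ha hb
      (u := (u % orderOf a).toNat) (by rw [← hnat, ← hu]; group)
  refine ⟨?_, hcomm⟩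
  have hau : a ^ u = a ^ (1 : ℤ) := by
    rw [← hu, mul_assoc, hcomm, inv_mul_cancel_left, zpow_one]
  rw [← hs]
  exact zpow_eq_zpow_iff_modEq.1 hau
end
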